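/- arXiv:1309.3625 — 5 statements merged into one kernel-verified Lean document; each statement's English description precedes it below -/
import Mathlib

section
/- There exist a constant c > 0 and a threshold d₀ such that for every integer d ≥ d₀ the following holds: for every set S of 2d points in general position in ℝ^d, the number of unordered pairs {A, B} of disjoint d-element subsets of S such that the intrinsic (relative) interiors of the convex hulls of A and of B have a common point is at least c · 2^d · (log d) / √d. -/
/-- A finite set of points in `ℝ^d` is in general position if every subset of at most
`d + 1` of the points is affinely independent. -/
def GenPos (d : ℕ) (S : Finset (EuclideanSpace ℝ (Fin d))) : Prop :=
  ∀ T ⊆ S, T.card ≤ d + 1 →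
    AffineIndependent ℝ (fun p : (T : Set (EuclideanSpace ℝ (Fin d))) =>
      (p : EuclideanSpace ℝ (Fin d)))

/-- The set of unordered pairs `{A, B}` of disjoint `k`-element subsets of `S` such that
the intrinsic (relative) interiors of the convex hulls of `A` and `B` intersect. -/
def crossingPairs (d k : ℕ) (S : Finset (EuclideanSpace ℝ (Fin d))) :
    Set (Sym2 (Finset (EuclideanSpace ℝ (Fin d)))) :=
  {q | ∃ A B : Finset (EuclideanSpace ℝ (Fin d)), q = s(A, B) ∧ A ⊆ S ∧ B ⊆ S ∧
    Disjoint A B ∧ A.card = k ∧ B.card = k ∧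
    (intrinsicInterior ℝ (convexHull ℝ (A : Set (EuclideanSpace ℝ (Fin d)))) ∩
      intrinsicInterior ℝ (convexHull ℝ (B : Set (EuclideanSpace ℝ (Fin d))))).Nonempty}


/-- Affine independence, in terms of weight functions. -/
lemma gp_indep {d : ℕ} {S T : Finset (EuclideanSpace ℝ (Fin d))} (hS : GenPos d S)
    (hT : T ⊆ S) (hc : T.card ≤ d + 1) (w : EuclideanSpace ℝ (Fin d) → ℝ)
    (h0 : ∑ x ∈ T, w x = 0) (h1 : ∑ x ∈ T, w x • x = 0) : ∀ x ∈ T, w x = 0 := by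
  have h := hS T hT hc
  rw [affineIndependent_iff] at h
  intro x hx
  have := h Finset.univ (fun p => w p) ?_ ?_ ⟨x, hx⟩ (Finset.mem_univ _)
  · exact this
  · rw [← h0]; exact Finset.sum_coe_sort T (fun x => w x)
  · rw [← h1]; exact Finset.sum_coe_sort T (fun x => w x • x)

set_option maxHeartbeats 1000000 in
lemma int_mem {d : ℕ} (A : Finset (EuclideanSpace ℝ (Fin d)))
    (hA : AffineIndependent ℝ (fun p : (A : Set (EuclideanSpace ℝ (Fin d))) =>
      (p : EuclideanSpace ℝ (Fin d))))
    (w : EuclideanSpace ℝ (Fin d) → ℝ) (hw : ∀ x ∈ A, 0 < w x) (h1 : ∑ x ∈ A, w x = 1) :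
    ∑ x ∈ A, w x • x ∈ intrinsicInterior ℝ (convexHull ℝ (A : Set (EuclideanSpace ℝ (Fin d)))) := by
  classical
  obtain ⟨t, hAt, htI, htop⟩ := exists_subset_affineIndependent_affineSpan_eq_top hA
  let b : AffineBasis t ℝ (EuclideanSpace ℝ (Fin d)) := ⟨((↑) : t → _), htI, by
    rw [Subtype.range_coe]; exact htop⟩
  have hb : ∀ j : t, b j = (j : EuclideanSpace ℝ (Fin d)) := fun j => rfl
  have : Finite t := b.finite
  have : Fintype t := Fintype.ofFinite t
  have hx : ∑ x ∈ A, w x • x ∈ convexHull ℝ (A : Set (EuclideanSpace ℝ (Fin d))) := by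
    rw [Finset.mem_convexHull']
    exact ⟨w, fun y hy => (hw y hy).le, h1, rfl⟩
  -- the coordinates vanish off `A` on the affine span
  have hoff : ∀ j : t, (j : EuclideanSpace ℝ (Fin d)) ∉ A → ∀ y ∈ affineSpan ℝ
      (A : Set (EuclideanSpace ℝ (Fin d))), b.coord j y = 0 := by
    intro j hj y hy
    refine affineSpan_induction (p := fun y => b.coord j y = 0) hy ?_ ?_
    · intro x hx
      have : b.coord j (b ⟨x, hAt hx⟩) = 0 := by
        apply b.coord_apply_ne
        rintro rfl
        exact hj hx
      exact this
    · intro c u v x hu hv hx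
      rw [AffineMap.map_vadd, map_smul, AffineMap.linearMap_vsub, hu, hv, hx]; simp
  have hcomb : ∀ a (ha : a ∈ A), b.coord ⟨a, hAt ha⟩ (∑ x ∈ A, w x • x) = w a := by
    intro a ha
    have e : ∑ x ∈ A, w x • x = A.affineCombination ℝ id w := by
      rw [Finset.affineCombination_eq_linear_combination _ _ _ h1]; rfl
    rw [e, Finset.map_affineCombination _ _ _ h1, Finset.affineCombination_eq_linear_combination _ _ _ h1]
    rw [Finset.sum_eq_single a]
    · have : b.coord ⟨a, hAt ha⟩ (b ⟨a, hAt ha⟩) = 1 := b.coord_apply_eq _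
      simp only [Function.comp, id]
      change w a • b.coord ⟨a, hAt ha⟩ (b ⟨a, hAt ha⟩) = _
      rw [this]; simp
    · intro c hc hca
      have : b.coord ⟨a, hAt ha⟩ (b ⟨c, hAt hc⟩) = 0 := by
        apply b.coord_apply_ne
        simpa [Subtype.ext_iff] using hca.symm
      simp only [Function.comp, id]
      change w c • b.coord ⟨a, hAt ha⟩ (b ⟨c, hAt hc⟩) = _
      rw [this]; simp
    · intro h; exact absurd ha h
  rw [mem_intrinsicInterior]
  refine ⟨⟨_, subset_affineSpan _ _ hx⟩, ?_, rfl⟩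
  rw [mem_interior]
  refine ⟨{y | ∀ j : t, (j : EuclideanSpace ℝ (Fin d)) ∈ A → 0 < b.coord j y}, ?_, ?_, ?_⟩
  · rintro ⟨y, hy⟩ hpos
    rw [affineSpan_convexHull] at hy
    simp only [Set.mem_ofPred_eq] at hpos
    show y ∈ convexHull ℝ (A : Set (EuclideanSpace ℝ (Fin d)))
    have key : ∀ {M : Type} [AddCommMonoid M] (f : t → M) (g : EuclideanSpace ℝ (Fin d) → M),
        (∀ j : t, (j : EuclideanSpace ℝ (Fin d)) ∉ A → f j = 0) →
        (∀ j : t, (j : EuclideanSpace ℝ (Fin d)) ∈ A → f j = g j) →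
        ∑ j, f j = ∑ x ∈ A, g x := by
      intro M _ f g hf hfg
      symm
      apply Finset.sum_bij_ne_zero (fun x hx _ => (⟨x, hAt hx⟩ : t))
      · intros; exact Finset.mem_univ _
      · intro a _ _ c _ _ h; simpa using h
      · intro j _ hj
        have hjA : (j : EuclideanSpace ℝ (Fin d)) ∈ A := by
          by_contra h; exact hj (hf j h)
        exact ⟨j, hjA, by rw [← hfg j hjA]; exact hj, rfl⟩
      · intro x hx _; exact (hfg ⟨x, hAt hx⟩ hx).symm
    rw [Finset.mem_convexHull']
    refine ⟨fun x => if h : x ∈ A then b.coord ⟨x, hAt h⟩ y else 0, ?_, ?_, ?_⟩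
    · intro x hx
      simp only [hx, dif_pos]
      exact (hpos ⟨x, hAt hx⟩ hx).le
    · rw [← b.sum_coord_apply_eq_one y]
      symm
      apply key
      · exact fun j hj => hoff j hj y hy
      · intro j hj; simp [hj]
    · conv_rhs => rw [← b.linear_combination_coord_eq_self y]
      symm
      apply key
      · intro j hj; rw [hoff j hj y hy]; simp
      · intro j hj; simp [hj, hb]
  · have : {y : affineSpan ℝ (convexHull ℝ (A : Set (EuclideanSpace ℝ (Fin d)))) | ∀ j : t, (j : EuclideanSpace ℝ (Fin d)) ∈ A → 0 < b.coord j y}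
      = ⋂ j : t, ⋂ _ : (j : EuclideanSpace ℝ (Fin d)) ∈ A, {y : affineSpan ℝ (convexHull ℝ (A : Set (EuclideanSpace ℝ (Fin d)))) | 0 < b.coord j y} := by
      ext; simp
    rw [this]
    refine isOpen_iInter_of_finite fun j => isOpen_iInter_of_finite fun _ => ?_
    exact isOpen_lt continuous_const
      ((AffineMap.continuous_of_finiteDimensional (b.coord j)).comp continuous_subtype_val)
  · intro j hj
    have := hcomb j hj
    have h2 := hw _ hj
    simp only [Subtype.coe_eta] at this
    rw [this]; exact h2

lemma cross_of_dep {d : ℕ} (hd : 0 < d) {S A B : Finset (EuclideanSpace ℝ (Fin d))}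
    (hS : GenPos d S) (hA : A ⊆ S) (hB : B ⊆ S) (hAc : A.card = d) (hBc : B.card = d)
    (w : EuclideanSpace ℝ (Fin d) → ℝ) (hwA : ∀ x ∈ A, 0 < w x) (hwB : ∀ x ∈ B, w x < 0)
    (h0 : ∑ x ∈ A, w x + ∑ x ∈ B, w x = 0) (h1 : ∑ x ∈ A, w x • x + ∑ x ∈ B, w x • x = 0) :
    (intrinsicInterior ℝ (convexHull ℝ (A : Set (EuclideanSpace ℝ (Fin d)))) ∩
      intrinsicInterior ℝ (convexHull ℝ (B : Set (EuclideanSpace ℝ (Fin d))))).Nonempty := by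
  have hne : A.Nonempty := by rw [← Finset.card_pos]; omega
  set s := ∑ x ∈ A, w x with hs
  have hspos : 0 < s := Finset.sum_pos hwA hne
  have hsB : ∑ x ∈ B, w x = -s := by linarith
  refine ⟨∑ x ∈ A, (s⁻¹ * w x) • x, ?_, ?_⟩
  · apply int_mem A (hS A hA (by omega))
    · intro x hx; have := hwA x hx; positivity
    · rw [← Finset.mul_sum, ← hs]; field_simp
  · have : ∑ x ∈ A, (s⁻¹ * w x) • x = ∑ x ∈ B, (-s⁻¹ * w x) • x := by
      simp only [mul_smul, ← Finset.smul_sum]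
      rw [eq_neg_of_add_eq_zero_left h1]; simp
    rw [this]
    apply int_mem B (hS B hB (by omega))
    · intro x hx
      have := hwB x hx
      have h3 : 0 < s⁻¹ := by positivity
      nlinarith
    · rw [← Finset.mul_sum, hsB]; field_simp

/-- Prescribing the values of an affine dependence off a set of `d+1` points. -/
lemma exists_dep {d : ℕ} {S T R : Finset (EuclideanSpace ℝ (Fin d))}
    (hS : GenPos d S) (hT : T ⊆ S) (hTc : T.card = d + 1) (hTR : T ⊆ R)
    (f : EuclideanSpace ℝ (Fin d) → ℝ) :
    ∃ w : EuclideanSpace ℝ (Fin d) → ℝ, (∀ x, x ∉ T → w x = f x) ∧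
      ∑ x ∈ R, w x = 0 ∧ ∑ x ∈ R, w x • x = 0 := by
  classical
  let Φ : (T → ℝ) →ₗ[ℝ] (ℝ × EuclideanSpace ℝ (Fin d)) :=
    { toFun := fun c => (∑ i, c i, ∑ i, c i • (i : EuclideanSpace ℝ (Fin d)))
      map_add' := by
        intro a b; ext1 <;> simp [Finset.sum_add_distrib, add_smul]
      map_smul' := by
        intro a b; ext1 <;> simp [Finset.mul_sum, Finset.smul_sum, mul_smul] }
  let ext : (T → ℝ) → EuclideanSpace ℝ (Fin d) → ℝ := fun c x => if h : x ∈ T then c ⟨x, h⟩ else f x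
  have e0 : ∀ c : T → ℝ, ∑ x ∈ T, ext c x = ∑ i, c i := by
    intro c
    rw [← Finset.sum_coe_sort T]
    apply Finset.sum_congr rfl; intro i _; simp [ext]
  have e1 : ∀ c : T → ℝ, ∑ x ∈ T, ext c x • x = ∑ i, c i • (i : EuclideanSpace ℝ (Fin d)) := by
    intro c
    rw [← Finset.sum_coe_sort T]
    apply Finset.sum_congr rfl; intro i _; simp [ext]
  have hinj : Function.Injective Φ := by
    rw [← LinearMap.ker_eq_bot, LinearMap.ker_eq_bot']
    intro c hc
    have hc0 : ∑ i, c i = 0 := congrArg Prod.fst hc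
    have hc1 : ∑ i, c i • (i : EuclideanSpace ℝ (Fin d)) = 0 := congrArg Prod.snd hc
    have := gp_indep hS hT (by omega) (ext c) (by rw [e0, hc0]) (by rw [e1, hc1])
    funext i
    have := this i i.2
    simpa [ext] using this
  have hsurj : Function.Surjective Φ := by
    rw [← LinearMap.injective_iff_surjective_of_finrank_eq_finrank]
    · exact hinj
    · simp [hTc, add_comm]
  obtain ⟨c, hc⟩ := hsurj (-∑ x ∈ R \ T, f x, -∑ x ∈ R \ T, f x • x)
  have hc0 : ∑ i, c i = -∑ x ∈ R \ T, f x := congrArg Prod.fst hc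
  have hc1 : ∑ i, c i • (i : EuclideanSpace ℝ (Fin d)) = -∑ x ∈ R \ T, f x • x :=
    congrArg Prod.snd hc
  have hoff : ∀ x, x ∉ T → ext c x = f x := fun x hx => by simp [ext, hx]
  refine ⟨ext c, hoff, ?_, ?_⟩
  · rw [← Finset.sum_sdiff hTR, e0, hc0, Finset.sum_congr rfl
      (fun x hx => hoff x (Finset.mem_sdiff.1 hx).2)]; simp
  · rw [← Finset.sum_sdiff hTR, e1, hc1, Finset.sum_congr rfl
      (fun x hx => by rw [hoff x (Finset.mem_sdiff.1 hx).2])]; simp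

lemma cross_extend {d : ℕ} (hd : 0 < d) {S D A B : Finset (EuclideanSpace ℝ (Fin d))}
    (hS : GenPos d S) (hD : D ⊆ S) (hDc : d + 1 ≤ D.card) (hA : A ⊆ S) (hB : B ⊆ S)
    (hAB : Disjoint A B) (hU : S ⊆ A ∪ B) (hAc : A.card = d) (hBc : B.card = d)
    (l : EuclideanSpace ℝ (Fin d) → ℝ) (hlA : ∀ x ∈ D, x ∈ A → 0 < l x)
    (hlB : ∀ x ∈ D, x ∈ B → l x < 0)
    (h0 : ∑ x ∈ D, l x = 0) (h1 : ∑ x ∈ D, l x • x = 0) :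
    (intrinsicInterior ℝ (convexHull ℝ (A : Set (EuclideanSpace ℝ (Fin d)))) ∩
      intrinsicInterior ℝ (convexHull ℝ (B : Set (EuclideanSpace ℝ (Fin d))))).Nonempty := by
  classical
  obtain ⟨T, hTD, hTc⟩ := Finset.exists_subset_card_eq hDc
  obtain ⟨w, hw, hw0, hw1⟩ := exists_dep hS (hTD.trans hD) hTc (hTD.trans hD)
    (fun x => if x ∈ A then 1 else -1)
  have hUS : A ∪ B = S := (Finset.union_subset hA hB).antisymm hU
  have hne : ∀ x ∈ D, 0 < |l x| := by
    intro x hx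
    rw [abs_pos]
    rcases Finset.mem_union.1 (hU (hD hx)) with h | h
    · exact (hlA x hx h).ne'
    · exact (hlB x hx h).ne
  have hev : ∀ᶠ ε in nhdsWithin (0 : ℝ) (Set.Ioi 0), ∀ x ∈ D, |ε * w x| < |l x| := by
    rw [Filter.eventually_all_finset]
    intro x hx
    have hc : Continuous (fun ε : ℝ => |ε * w x|) := by fun_prop
    have ht : Filter.Tendsto (fun ε : ℝ => |ε * w x|) (nhdsWithin (0 : ℝ) (Set.Ioi 0)) (nhds 0) := by
      have := hc.tendsto 0
      simp only [zero_mul, abs_zero] at this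
      exact this.mono_left nhdsWithin_le_nhds
    exact ht.eventually (gt_mem_nhds (hne x hx))
  obtain ⟨ε, hε, hpos⟩ := (hev.and self_mem_nhdsWithin).exists
  have hpos : 0 < ε := hpos
  refine cross_of_dep hd hS hA hB hAc hBc (fun x => (if x ∈ D then l x else 0) + ε * w x) ?_ ?_ ?_ ?_
  · intro x hx
    by_cases hxD : x ∈ D
    · have h2 := hlA x hxD hx
      have h3 := hε x hxD
      rw [abs_of_pos h2] at h3
      have := (abs_lt.1 h3).1
      simp only [hxD, if_true]; linarith
    · have : w x = 1 := by rw [hw x (fun h => hxD (hTD h))]; simp [hx]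
      simp [hxD, this, hpos]
  · intro x hx
    by_cases hxD : x ∈ D
    · have h2 := hlB x hxD hx
      have h3 := hε x hxD
      rw [abs_of_neg h2] at h3
      have := (abs_lt.1 h3).2
      simp only [hxD, if_true]; linarith
    · have hxA : x ∉ A := fun h => Finset.disjoint_left.1 hAB h hx
      have : w x = -1 := by rw [hw x (fun h => hxD (hTD h))]; simp [hxA]
      simp [hxD, this, hpos]
  · rw [← Finset.sum_union hAB, hUS, Finset.sum_add_distrib, ← Finset.mul_sum, hw0,
      Finset.sum_ite_mem, Finset.inter_eq_right.2 hD, h0]; simp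
  · rw [← Finset.sum_union hAB, hUS]
    simp only [add_smul, mul_smul, ite_smul, zero_smul]
    rw [Finset.sum_add_distrib, ← Finset.smul_sum, hw1,
      Finset.sum_ite_mem, Finset.inter_eq_right.2 hD, h1]; simp

/-- A generic pencil of affine dependences. -/
lemma pencil {d : ℕ} {S D : Finset (EuclideanSpace ℝ (Fin d))}
    (hS : GenPos d S) (hD : D ⊆ S) (hDc : D.card = d + 3) :
    ∃ u v : EuclideanSpace ℝ (Fin d) → ℝ,
      (∑ x ∈ D, u x = 0 ∧ ∑ x ∈ D, u x • x = 0) ∧ (∑ x ∈ D, v x = 0 ∧ ∑ x ∈ D, v x • x = 0) ∧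
      (∀ x ∈ D, v x ≠ 0) ∧ ∀ x ∈ D, ∀ y ∈ D, x ≠ y → u x * v y ≠ u y * v x := by
  classical
  obtain ⟨T, hTD, hTc⟩ := Finset.exists_subset_card_eq (show d + 1 ≤ D.card by omega)
  have h2 : (D \ T).card = 2 := by rw [Finset.card_sdiff_of_subset hTD]; omega
  obtain ⟨p, q, hpq, hpq'⟩ := Finset.card_eq_two.1 h2
  have hp : p ∈ D \ T := by rw [hpq']; simp
  have hq : q ∈ D \ T := by rw [hpq']; simp
  rw [Finset.mem_sdiff] at hp hq
  obtain ⟨u, hu, hu0, hu1⟩ := exists_dep hS (hTD.trans hD) hTc hTD (fun x => if x = p then 1 else 0)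
  obtain ⟨v, hv, hv0, hv1⟩ := exists_dep hS (hTD.trans hD) hTc hTD (fun x => if x = q then 1 else 0)
  have hup : u p = 1 := by rw [hu p hp.2]; simp
  have huq : u q = 0 := by rw [hu q hq.2]; simp [hpq.symm]
  have hvp : v p = 0 := by rw [hv p hp.2]; simp [hpq]
  have hvq : v q = 1 := by rw [hv q hq.2]; simp
  -- no nonzero combination vanishes at two points
  have key : ∀ a b : ℝ, ∀ x ∈ D, ∀ y ∈ D, x ≠ y → a * u x + b * v x = 0 → a * u y + b * v y = 0 →
      a = 0 ∧ b = 0 := by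
    intro a b x hx y hy hxy ex ey
    have hsub : D \ {x, y} ⊆ D := Finset.sdiff_subset
    have hxyD : ({x, y} : Finset (EuclideanSpace ℝ (Fin d))) ⊆ D := by
      intro z hz; simp only [Finset.mem_insert, Finset.mem_singleton] at hz
      rcases hz with rfl | rfl <;> assumption
    have hz : ∀ z ∈ D, z ∉ D \ {x, y} → a * u z + b * v z = 0 := by
      intro z hz hz'
      have : z = x ∨ z = y := by
        simp only [Finset.mem_sdiff, Finset.mem_insert, Finset.mem_singleton] at hz'
        tauto
      rcases this with rfl | rfl <;> assumption
    have := gp_indep hS (hsub.trans hD) (by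
        rw [Finset.card_sdiff_of_subset hxyD, Finset.card_pair hxy]; omega)
      (fun z => a * u z + b * v z)
      (by
        rw [Finset.sum_subset hsub hz, Finset.sum_add_distrib, ← Finset.mul_sum, ← Finset.mul_sum,
          hu0, hv0]; simp)
      (by
        rw [Finset.sum_subset hsub (fun z h h' => by simp only [hz z h h', zero_smul])]
        simp only [add_smul, mul_smul]
        rw [Finset.sum_add_distrib, ← Finset.smul_sum, ← Finset.smul_sum, hu1, hv1]; simp)
    have hall : ∀ z ∈ D, a * u z + b * v z = 0 := by
      intro z hzD
      by_cases h : z ∈ D \ {x, y}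
      · exact this z h
      · exact hz z hzD h
    have e1 := hall p hp.1
    have e2 := hall q hq.1
    rw [hup, hvp] at e1
    rw [huq, hvq] at e2
    constructor <;> linarith
  have hne : ∀ x ∈ D, ∀ y ∈ D, x ≠ y → u x * v y ≠ u y * v x := by
    intro x hx y hy hxy h
    have k1 := key (v x) (-u x) x hx y hy hxy (by ring) (by linarith)
    have k2 := key (v y) (-u y) x hx y hy hxy (by linarith) (by ring)
    have k3 := key 1 0 x hx y hy hxy (by linarith) (by linarith)
    exact one_ne_zero k3.1
  obtain ⟨t, ht⟩ := Infinite.exists_notMem_finset (D.image (fun x => -v x / u x))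
  refine ⟨u, fun x => v x + t * u x, ⟨hu0, hu1⟩, ⟨?_, ?_⟩, ?_, ?_⟩
  · rw [Finset.sum_add_distrib, ← Finset.mul_sum, hu0, hv0]; simp
  · simp only [add_smul, mul_smul]
    rw [Finset.sum_add_distrib, ← Finset.smul_sum, hu1, hv1]; simp
  · intro x hx h
    by_cases hux : u x = 0
    · have hvx : v x = 0 := by simpa [hux] using h
      obtain ⟨y, hy, hyx⟩ := Finset.exists_mem_ne (show 1 < D.card by omega) x
      exact hne x hx y hy hyx.symm (by rw [hux, hvx]; ring)
    · apply ht
      rw [Finset.mem_image]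
      refine ⟨x, hx, ?_⟩
      field_simp; linarith
  · intro x hx y hy hxy h
    exact hne x hx y hy hxy (by linarith)

lemma sorted_pencil {d : ℕ} {S D : Finset (EuclideanSpace ℝ (Fin d))}
    (hS : GenPos d S) (hD : D ⊆ S) (hDc : D.card = d + 3) :
    ∃ (p : ℕ → EuclideanSpace ℝ (Fin d)) (e : ℕ → Prop),
      Set.InjOn p (Finset.range (d + 3)) ∧ (∀ i < d + 3, p i ∈ D) ∧
      (∀ x ∈ D, ∃ i < d + 3, p i = x) ∧
      ∀ k < d + 3, ∃ l : EuclideanSpace ℝ (Fin d) → ℝ,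
        ∑ x ∈ D, l x = 0 ∧ ∑ x ∈ D, l x • x = 0 ∧
        ∀ i < d + 3, ((i < k ↔ e i) → 0 < l (p i)) ∧ (¬ (i < k ↔ e i) → l (p i) < 0) := by
  classical
  obtain ⟨u, v, ⟨hu0, hu1⟩, ⟨hv0, hv1⟩, hv, huv⟩ := pencil hS hD hDc
  let τ : EuclideanSpace ℝ (Fin d) → ℝ := fun x => - u x / v x
  have hτ : Set.InjOn τ D := by
    intro x hx y hy h
    by_contra hxy
    apply huv x hx y hy hxy
    have h1 := hv x hx
    have h2 := hv y hy
    simp only [τ] at h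
    rw [div_eq_div_iff h1 h2] at h
    linarith
  have hc : (D.image τ).card = d + 3 := by rw [Finset.card_image_of_injOn hτ, hDc]
  let o := (D.image τ).orderIsoOfFin hc
  have hch : ∀ i : ℕ, ∃ x, ∀ h : i < d + 3, x ∈ D ∧ τ x = (o ⟨i, h⟩ : ℝ) := by
    intro i
    by_cases h : i < d + 3
    · obtain ⟨x, hx, hx'⟩ := Finset.mem_image.1 (o ⟨i, h⟩).2
      exact ⟨x, fun _ => ⟨hx, hx'⟩⟩
    · exact ⟨0, fun h' => absurd h' h⟩
  choose p hp using hch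
  have hmono : ∀ i j, i < d + 3 → j < d + 3 → i < j → τ (p i) < τ (p j) := by
    intro i j hi hj hij
    rw [(hp i hi).2, (hp j hj).2]
    have : o ⟨i, hi⟩ < o ⟨j, hj⟩ := o.strictMono hij
    exact this
  refine ⟨p, fun i => 0 < v (p i), ?_, fun i hi => (hp i hi).1, ?_, ?_⟩
  · intro i hi j hj h
    have hi : i < d + 3 := by simpa using hi
    have hj : j < d + 3 := by simpa using hj
    rcases lt_trichotomy i j with hij | hij | hij
    · exact absurd (hmono i j hi hj hij) (by rw [h]; exact lt_irrefl _)
    · exact hij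
    · exact absurd (hmono j i hj hi hij) (by rw [h]; exact lt_irrefl _)
  · intro x hx
    obtain ⟨i, hi⟩ := o.surjective ⟨τ x, Finset.mem_image_of_mem _ hx⟩
    refine ⟨i, i.2, ?_⟩
    apply hτ (hp i i.2).1 hx
    rw [(hp i i.2).2]
    simp [hi]
  · intro k hk
    have hθ : ∃ θ : ℝ, ∀ i < d + 3, (i < k → τ (p i) < θ) ∧ (¬ i < k → θ < τ (p i)) := by
      rcases Nat.eq_zero_or_pos k with rfl | hkpos
      · refine ⟨τ (p 0) - 1, fun i hi => ⟨fun h => absurd h (by omega), fun _ => ?_⟩⟩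
        rcases Nat.eq_zero_or_pos i with rfl | h
        · linarith
        · have := hmono 0 i (by omega) hi h; linarith
      · obtain ⟨θ, h1, h2⟩ := exists_between (hmono (k - 1) k (by omega) hk (by omega))
        refine ⟨θ, fun i hi => ⟨fun h => ?_, fun h => ?_⟩⟩
        · rcases Nat.lt_or_ge i (k - 1) with h' | h'
          · exact (hmono i (k - 1) hi (by omega) h').trans h1
          · have : i = k - 1 := by omega
            rw [this]; exact h1
        · rcases Nat.lt_or_ge k i with h' | h'
          · exact h2.trans (hmono k i hk hi h')
          · have : i = k := by omega
            rw [this]; exact h2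
    obtain ⟨θ, hθ⟩ := hθ
    refine ⟨fun x => u x + θ * v x, ?_, ?_, ?_⟩
    · rw [Finset.sum_add_distrib, ← Finset.mul_sum, hu0, hv0]; simp
    · simp only [add_smul, mul_smul]
      rw [Finset.sum_add_distrib, ← Finset.smul_sum, hu1, hv1]; simp
    · intro i hi
      have hvi := hv _ (hp i hi).1
      have heq : u (p i) + θ * v (p i) = v (p i) * (θ - τ (p i)) := by
        simp only [τ]; field_simp; ring
      simp only [heq]
      have := hθ i hi
      by_cases hik : i < k
      · have h1 : 0 < θ - τ (p i) := by linarith [this.1 hik]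
        constructor
        · intro h; exact mul_pos (h.1 hik) h1
        · intro h
          have : v (p i) < 0 := lt_of_le_of_ne (by by_contra h'; exact h (by simp [hik]; linarith)) hvi
          exact mul_neg_of_neg_of_pos this h1
      · have h1 : θ - τ (p i) < 0 := by linarith [this.2 hik]
        constructor
        · intro h
          have : v (p i) < 0 := lt_of_le_of_ne (by by_contra h'; exact hik (h.2 (by linarith))) hvi
          exact mul_pos_of_neg_of_neg this h1
        · intro h
          have : 0 < v (p i) := by by_contra h'; exact h (by simp [hik]; linarith)
          exact mul_neg_of_pos_of_neg this h1

lemma cb_lower (n : ℕ) : 16 ^ n ≤ 4 * (n + 1) * Nat.centralBinom n ^ 2 := by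
  have key : ∀ n : ℕ, 1 ≤ n → 16 ^ n ≤ 4 * n * Nat.centralBinom n ^ 2 := by
    intro n hn
    induction n, hn using Nat.le_induction with
    | base => norm_num [Nat.centralBinom, Nat.choose]
    | succ n hn ih =>
      have h := Nat.succ_mul_centralBinom_succ n
      have h2 : (n + 1) * 16 ^ (n + 1) ≤ (n + 1) * (4 * (n + 1) * Nat.centralBinom (n + 1) ^ 2) := by
        calc (n + 1) * 16 ^ (n + 1) = 16 * (n + 1) * 16 ^ n := by ring
          _ ≤ 16 * (n + 1) * (4 * n * Nat.centralBinom n ^ 2) := by gcongr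
          _ = 16 * (4 * n * (n + 1)) * Nat.centralBinom n ^ 2 := by ring
          _ ≤ 16 * ((2 * n + 1) ^ 2) * Nat.centralBinom n ^ 2 := by gcongr; nlinarith
          _ = 4 * (2 * (2 * n + 1) * Nat.centralBinom n) ^ 2 := by ring
          _ = 4 * ((n + 1) * Nat.centralBinom (n + 1)) ^ 2 := by rw [h]
          _ = _ := by ring
      exact Nat.le_of_mul_le_mul_left h2 (by omega)
  rcases Nat.eq_zero_or_pos n with rfl | h
  · simp
  · exact (key n h).trans (by gcongr; omega)

lemma choose_near (h r : ℕ) : r ≤ h →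
    ((h : ℝ) - r ^ 2) * Nat.centralBinom h ≤ h * ((2 * h).choose (h + r)) := by
  induction r with
  | zero => intro _; simp [Nat.centralBinom]
  | succ r ih =>
    intro hr
    have ih := ih (by omega)
    have e := Nat.choose_succ_right_eq (2 * h) (h + r)
    have e' : ((2 * h).choose (h + r + 1) : ℝ) * (h + r + 1) = (2 * h).choose (h + r) * (h - r) := by
      have h3 : 2 * h - (h + r) = h - r := by omega
      rw [h3] at e
      have := congrArg (Nat.cast : ℕ → ℝ) e
      push_cast [Nat.cast_sub (show r ≤ h by omega)] at this
      linarith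
    have hrr : (0 : ℝ) ≤ h - r := by
      have : (r : ℝ) ≤ h := by exact_mod_cast (show r ≤ h by omega)
      linarith
    have hpos : (0 : ℝ) < h + r + 1 := by positivity
    rw [← add_assoc]
    refine le_of_mul_le_mul_right ?_ hpos
    rw [mul_assoc (h : ℝ), e']
    have hm := mul_le_mul_of_nonneg_right ih hrr
    have hcb : (0 : ℝ) ≤ Nat.centralBinom h := by positivity
    have hpoly : ((h : ℝ) - (r + 1) ^ 2) * (h + r + 1) ≤ (h - r ^ 2) * (h - r) := by
      have : (0 : ℝ) ≤ (r : ℝ) := by positivity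
      nlinarith [pow_nonneg this 3, pow_nonneg this 2]
    have := mul_le_mul_of_nonneg_right hpoly hcb
    push_cast
    nlinarith

lemma choose_half {h r : ℕ} (hr : 2 * r ^ 2 ≤ h) (hh : 0 < h) :
    (Nat.centralBinom h : ℝ) / 2 ≤ (2 * h).choose (h + r) := by
  have h1 := choose_near h r (by nlinarith)
  have h2 : (2 : ℝ) * r ^ 2 ≤ h := by exact_mod_cast hr
  have h3 : (0 : ℝ) < h := by exact_mod_cast hh
  have hcb : (0 : ℝ) ≤ Nat.centralBinom h := by positivity
  refine le_of_mul_le_mul_left ?_ h3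
  nlinarith

lemma choose_window {m h s j : ℕ} (hm : h = m / 2) (hs : 2 * s ^ 2 ≤ h) (hh : 0 < h)
    (h1 : h ≤ j + s) (h2 : j ≤ h + s) :
    (Nat.centralBinom h : ℝ) / 2 ≤ m.choose j := by
  have hle : (2 * h).choose j ≤ m.choose j := Nat.choose_le_choose j (by omega)
  have : (Nat.centralBinom h : ℝ) / 2 ≤ (2 * h).choose j := by
    rcases le_total h j with hj | hj
    · obtain ⟨r, rfl⟩ := Nat.exists_eq_add_of_le hj
      have : r ≤ s := by omega
      exact choose_half (by nlinarith) hh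
    · obtain ⟨r, hr⟩ := Nat.exists_eq_add_of_le hj
      have : r ≤ s := by omega
      have e : (2 * h).choose j = (2 * h).choose (h + r) := by
        rw [← Nat.choose_symm (show j ≤ 2 * h by omega)]; congr 1; omega
      rw [e]
      exact choose_half (by nlinarith) hh
  exact this.trans (by exact_mod_cast hle)

lemma ivt_int (n : ℕ) (f : ℕ → ℤ) (h0 : f 0 ≤ 0) (hn : 0 ≤ f n)
    (hst : ∀ k, f (k + 1) ≤ f k + 2) : ∃ k ≤ n, 0 ≤ f k ∧ f k ≤ 1 := by
  classical
  have hex : ∃ k, 0 ≤ f k := ⟨n, hn⟩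
  refine ⟨Nat.find hex, Nat.find_le hn, Nat.find_spec hex, ?_⟩
  rcases Nat.eq_zero_or_pos (Nat.find hex) with h | h
  · rw [h]; omega
  · have := Nat.find_min hex (Nat.sub_one_lt_of_lt h)
    have h2 := hst (Nat.find hex - 1)
    rw [Nat.sub_add_cancel h] at h2
    omega

open Classical in
/-- The size of the positive side after `k` sign flips. -/
noncomputable def cnt (n : ℕ) (e : ℕ → Prop) (k : ℕ) : ℕ :=
  ((Finset.range n).filter (fun i => (i < k ↔ e i))).card

lemma cnt_step (n : ℕ) (e : ℕ → Prop) (k : ℕ) :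
    cnt n e (k + 1) ≤ cnt n e k + 1 ∧ cnt n e k ≤ cnt n e (k + 1) + 1 := by
  classical
  unfold cnt
  constructor
  · refine le_trans (Finset.card_le_card (t := insert k _) ?_) (Finset.card_insert_le _ _)
    intro i hi
    simp only [Finset.mem_filter, Finset.mem_insert] at *
    rcases eq_or_ne i k with h | h
    · exact Or.inl h
    · right; have : i < k + 1 ↔ i < k := by omega
      rw [← this]; exact hi
  · refine le_trans (Finset.card_le_card (t := insert k _) ?_) (Finset.card_insert_le _ _)
    intro i hi
    simp only [Finset.mem_filter, Finset.mem_insert] at *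
    rcases eq_or_ne i k with h | h
    · exact Or.inl h
    · right; have : i < k + 1 ↔ i < k := by omega
      rw [this]; exact hi

lemma cnt_ends (n : ℕ) (e : ℕ → Prop) : cnt n e 0 + cnt n e n = n := by
  classical
  unfold cnt
  have h := Finset.card_filter_add_card_filter_not (s := Finset.range n) (fun i => e i)
  rw [Finset.card_range] at h
  have e1 : (Finset.range n).filter (fun i => (i < n ↔ e i)) = (Finset.range n).filter e := by
    apply Finset.filter_congr; intro i hi; simp [Finset.mem_range.1 hi]
  have e2 : (Finset.range n).filter (fun i => (i < 0 ↔ e i)) =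
      (Finset.range n).filter (fun i => ¬ e i) := by
    apply Finset.filter_congr; intro i hi; simp
  rw [e1, e2, add_comm]
  convert h using 2

lemma cnt_lip (n : ℕ) (e : ℕ → Prop) (k j : ℕ) :
    cnt n e (k + j) ≤ cnt n e k + j ∧ cnt n e k ≤ cnt n e (k + j) + j := by
  induction j with
  | zero => simp
  | succ j ih => have := cnt_step n e (k + j); rw [← add_assoc]; omega

lemma cnt_mid (n : ℕ) (e : ℕ → Prop) :
    ∃ k ≤ n, 2 * cnt n e k ≤ n + 1 ∧ n ≤ 2 * cnt n e k + 1 := by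
  have he := cnt_ends n e
  rcases le_total (2 * cnt n e 0) n with h | h
  · obtain ⟨k, hk, h1, h2⟩ := ivt_int n (fun k => 2 * (cnt n e k : ℤ) - n) (by omega)
      (by omega) (fun k => by have := cnt_step n e k; omega)
    exact ⟨k, hk, by omega, by omega⟩
  · obtain ⟨k, hk, h1, h2⟩ := ivt_int n (fun k => n - 2 * (cnt n e k : ℤ)) (by omega)
      (by omega) (fun k => by have := cnt_step n e k; omega)
    exact ⟨k, hk, by omega, by omega⟩

lemma cnt_window (n : ℕ) (e : ℕ → Prop) (s : ℕ) (hs : 2 * s ≤ n) :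
    ∃ K : Finset ℕ, K.card = s ∧ ∀ k ∈ K, k < n ∧
      2 * cnt n e k ≤ n + 1 + 2 * s ∧ n ≤ 2 * cnt n e k + 1 + 2 * s := by
  obtain ⟨k, hk, h1, h2⟩ := cnt_mid n e
  by_cases hks : k + s ≤ n
  · refine ⟨Finset.Ico k (k + s), by simp, fun j hj => ?_⟩
    rw [Finset.mem_Ico] at hj
    obtain ⟨r, rfl⟩ := Nat.exists_eq_add_of_le hj.1
    have := cnt_lip n e k r
    omega
  · refine ⟨Finset.Ico (k - s) k, by simp; omega, fun j hj => ?_⟩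
    rw [Finset.mem_Ico] at hj
    obtain ⟨r, rfl⟩ := Nat.exists_eq_add_of_le hj.2.le
    have := cnt_lip n e j r
    omega

lemma count_lower {d s : ℕ} (hd : 3 ≤ d) (hsd : 2 * s ≤ d + 3) (hsd' : s + 4 ≤ d / 2)
    {S : Finset (EuclideanSpace ℝ (Fin d))}
    (hSc : S.card = 2 * d) (hS : GenPos d S) (M : ℝ)
    (hM : ∀ j, (d - 3) / 2 ≤ j + (s + 2) → j ≤ (d - 3) / 2 + (s + 2) → M ≤ (d - 3).choose j) :
    s * M ≤ ((crossingPairs d d S).ncard : ℝ) := by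
  classical
  obtain ⟨D, hDS, hDc⟩ := Finset.exists_subset_card_eq (show d + 3 ≤ S.card by omega)
  obtain ⟨p, e, hinj, hpD, hsurj, hl⟩ := sorted_pencil hS hDS hDc
  obtain ⟨K, hKc, hK⟩ := cnt_window (d + 3) e s hsd
  let I : ℕ → Finset ℕ := fun k => (Finset.range (d + 3)).filter (fun i => (i < k ↔ e i))
  let A0 : ℕ → Finset (EuclideanSpace ℝ (Fin d)) := fun k => (I k).image p
  have hA0mem : ∀ k, ∀ i < d + 3, (p i ∈ A0 k ↔ (i < k ↔ e i)) := by
    intro k i hi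
    simp only [A0, I, Finset.mem_image, Finset.mem_filter, Finset.mem_range]
    constructor
    · rintro ⟨j, ⟨hj, hj'⟩, hji⟩
      have : j = i := hinj (by simpa using hj) (by simpa using hi) hji
      rwa [this] at hj'
    · intro h; exact ⟨i, ⟨hi, h⟩, rfl⟩
  have hA0D : ∀ k, A0 k ⊆ D := by
    intro k x hx
    simp only [A0, I, Finset.mem_image, Finset.mem_filter, Finset.mem_range] at hx
    obtain ⟨j, ⟨hj, _⟩, rfl⟩ := hx
    exact hpD j hj
  have hA0c : ∀ k, (A0 k).card = cnt (d + 3) e k := by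
    intro k
    rw [Finset.card_image_of_injOn]
    · unfold cnt; congr
    · apply hinj.mono
      intro i hi
      have := Finset.mem_filter.1 hi
      exact_mod_cast this.1
  have hSDc : (S \ D).card = d - 3 := by rw [Finset.card_sdiff_of_subset hDS]; omega
  let F : Finset (Σ _ : ℕ, Finset (EuclideanSpace ℝ (Fin d))) :=
    K.sigma (fun k => (S \ D).powersetCard (d - cnt (d + 3) e k))
  let G : (Σ _ : ℕ, Finset (EuclideanSpace ℝ (Fin d))) → Finset (EuclideanSpace ℝ (Fin d)) :=
    fun a => A0 a.1 ∪ a.2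
  have hGD : ∀ a ∈ F, ∀ x ∈ D, (x ∈ G a ↔ x ∈ A0 a.1) := by
    intro a ha x hx
    have h2 := (Finset.mem_powersetCard.1 (Finset.mem_sigma.1 ha).2).1
    simp only [G, Finset.mem_union]
    constructor
    · rintro (h | h)
      · exact h
      · exact absurd hx (Finset.mem_sdiff.1 (h2 h)).2
    · exact Or.inl
  have hGS : ∀ a ∈ F, G a ⊆ S := by
    intro a ha
    have h2 := (Finset.mem_powersetCard.1 (Finset.mem_sigma.1 ha).2).1
    exact Finset.union_subset ((hA0D _).trans hDS) (h2.trans Finset.sdiff_subset)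
  have hGc : ∀ a ∈ F, (G a).card = d := by
    intro a ha
    have h1 := hK _ (Finset.mem_sigma.1 ha).1
    have h2 := Finset.mem_powersetCard.1 (Finset.mem_sigma.1 ha).2
    rw [Finset.card_union_of_disjoint, hA0c, h2.2]
    · omega
    · rw [Finset.disjoint_left]
      intro x hx hx'
      exact (Finset.mem_sdiff.1 (h2.1 hx')).2 (hA0D _ hx)
  have hlast : ∀ a ∈ F, (p (d + 2) ∈ G a ↔ ¬ e (d + 2)) := by
    intro a ha
    have h1 := hK _ (Finset.mem_sigma.1 ha).1
    rw [hGD a ha _ (hpD _ (by omega)), hA0mem _ _ (by omega)]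
    have : ¬ (d + 2 < a.1) := by omega
    simp [this]
  have hGinj : Set.InjOn G F := by
    intro a ha b hb hab
    have ha' : a ∈ F := ha
    have hb' : b ∈ F := hb
    have hK1 := hK _ (Finset.mem_sigma.1 ha').1
    have hK2 := hK _ (Finset.mem_sigma.1 hb').1
    have hpat : ∀ i < d + 3, ((i < a.1 ↔ e i) ↔ (i < b.1 ↔ e i)) := by
      intro i hi
      rw [← hA0mem _ i hi, ← hA0mem _ i hi, ← hGD a ha' _ (hpD i hi), ← hGD b hb' _ (hpD i hi), hab]
    have h1 : a.1 = b.1 := by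
      rcases lt_trichotomy a.1 b.1 with h | h | h
      · have := hpat a.1 (by omega)
        simp only [lt_irrefl, h] at this
        tauto
      · exact h
      · have := hpat b.1 (by omega)
        simp only [lt_irrefl, h] at this
        tauto
    have hrec : ∀ c ∈ F, c.2 = G c \ D := by
      intro c hc
      have h2 := (Finset.mem_powersetCard.1 (Finset.mem_sigma.1 hc).2).1
      ext x
      simp only [G, Finset.mem_sdiff, Finset.mem_union]
      constructor
      · intro h; exact ⟨Or.inr h, (Finset.mem_sdiff.1 (h2 h)).2⟩
      · rintro ⟨h | h, h'⟩
        · exact absurd (hA0D _ h) h'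
        · exact h
    have h2 : a.2 = b.2 := by rw [hrec a ha', hrec b hb', hab]
    obtain ⟨a1, a2⟩ := a
    obtain ⟨b1, b2⟩ := b
    simp only at h1 h2
    rw [h1, h2]
  let H : (Σ _ : ℕ, Finset (EuclideanSpace ℝ (Fin d))) → Sym2 (Finset (EuclideanSpace ℝ (Fin d))) :=
    fun a => s(G a, S \ G a)
  have hHinj : Set.InjOn H F := by
    intro a ha b hb hab
    apply hGinj ha hb
    simp only [H, Sym2.eq_iff] at hab
    rcases hab with h | h
    · exact h.1
    · exfalso
      have h1 := hlast a ha
      have h2 := hlast b hb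
      have h3 : p (d + 2) ∈ G a ↔ p (d + 2) ∈ S \ G b := by rw [h.1]
      have h4 : p (d + 2) ∈ S := hDS (hpD _ (by omega))
      simp only [Finset.mem_sdiff, h4, true_and] at h3
      tauto
  have hfin : (crossingPairs d d S).Finite := by
    apply Set.Finite.subset (Finset.finite_toSet ((S.powerset ×ˢ S.powerset).image
      (fun q => s(q.1, q.2))))
    rintro q ⟨A, B, rfl, hA, hB, _⟩
    simp only [Finset.coe_image, Set.mem_image, Finset.mem_coe, Finset.mem_product,
      Finset.mem_powerset]
    exact ⟨(A, B), ⟨hA, hB⟩, rfl⟩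
  have hsub : ((F.image H : Finset _) : Set (Sym2 (Finset (EuclideanSpace ℝ (Fin d))))) ⊆
      crossingPairs d d S := by
    intro q hq
    obtain ⟨a, ha, rfl⟩ := Finset.mem_image.1 (Finset.mem_coe.1 hq)
    have hcB : (S \ G a).card = d := by
      rw [Finset.card_sdiff_of_subset (hGS a ha), hGc a ha]; omega
    refine ⟨G a, S \ G a, rfl, hGS a ha, Finset.sdiff_subset, Finset.disjoint_sdiff, hGc a ha, hcB, ?_⟩
    have hk := hK _ (Finset.mem_sigma.1 ha).1
    obtain ⟨l, hl0, hl1, hl2⟩ := hl a.1 hk.1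
    refine cross_extend (by omega) hS hDS (by omega) (hGS a ha) Finset.sdiff_subset
      Finset.disjoint_sdiff (by rw [Finset.union_sdiff_of_subset (hGS a ha)]) (hGc a ha) hcB l
      ?_ ?_ hl0 hl1
    · intro x hx hxG
      rw [hGD a ha x hx] at hxG
      obtain ⟨i, hi, rfl⟩ := hsurj x hx
      exact (hl2 i hi).1 ((hA0mem _ i hi).1 hxG)
    · intro x hx hxG
      have hxG := (Finset.mem_sdiff.1 hxG).2
      rw [hGD a ha x hx] at hxG
      obtain ⟨i, hi, rfl⟩ := hsurj x hx
      exact (hl2 i hi).2 (fun h => hxG ((hA0mem _ i hi).2 h))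
  have hcard : F.card ≤ (crossingPairs d d S).ncard := by
    rw [← Finset.card_image_of_injOn hHinj, ← Set.ncard_coe_finset]
    exact Set.ncard_le_ncard hsub hfin
  have hF : (s : ℝ) * M ≤ F.card := by
    simp only [F, Finset.card_sigma, Finset.card_powersetCard, hSDc]
    push_cast
    rw [← hKc, ← nsmul_eq_mul]
    apply Finset.card_nsmul_le_sum
    intro k hk
    have := hK k hk
    apply hM <;> omega
  exact hF.trans (by exact_mod_cast hcard)

theorem crossing_lower_bound_2d_points :
    ∃ c : ℝ, 0 < c ∧ ∃ d₀ : ℕ, ∀ d : ℕ, d₀ ≤ d →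
      ∀ S : Finset (EuclideanSpace ℝ (Fin d)), S.card = 2 * d → GenPos d S →
        c * 2 ^ d * Real.log d / Real.sqrt d ≤ ((crossingPairs d d S).ncard : ℝ) := by
  refine ⟨1 / 2048, by norm_num, 10000, fun d hd S hSc hS => ?_⟩
  obtain ⟨h, hh⟩ : ∃ h, h = (d - 3) / 2 := ⟨_, rfl⟩
  obtain ⟨r, hr⟩ : ∃ r, r = Nat.sqrt h := ⟨_, rfl⟩
  obtain ⟨s, hs⟩ : ∃ s, s = r / 2 - 2 := ⟨_, rfl⟩
  have hr1 : r * r ≤ h := hr ▸ Nat.sqrt_le h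
  have hr2 : h < (r + 1) * (r + 1) := hr ▸ Nat.lt_succ_sqrt h
  have hr3 : 64 ≤ r := by by_contra hcon; have : r + 1 ≤ 64 := by omega
                          have := Nat.mul_le_mul this this
                          omega
  have hs2 : 2 * (s + 2) ^ 2 ≤ h := by
    have : 2 * (s + 2) ≤ r := by omega
    nlinarith [Nat.mul_le_mul this this]
  have hrh : 64 * r ≤ h := by nlinarith
  have hmain := count_lower (d := d) (s := s) (by omega) (by omega) (by omega) hSc hS
    ((Nat.centralBinom h : ℝ) / 2)
    (fun j h1 h2 => choose_window hh hs2 (by omega) (by omega) (by omega))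
  refine le_trans ?_ hmain
  have hsr : (r : ℝ) + 1 ≤ 4 * s := by exact_mod_cast (show r + 1 ≤ 4 * s by omega)
  -- `h + 1 ≤ (r+1)^2`
  have hcb : (4 : ℝ) ^ h ≤ 2 * (r + 1) * Nat.centralBinom h := by
    have h1 := cb_lower h
    have h2 : (4 ^ h) ^ 2 ≤ (2 * (r + 1) * Nat.centralBinom h) ^ 2 := by
      calc (4 ^ h) ^ 2 = 16 ^ h := by rw [← pow_mul, mul_comm, pow_mul]; norm_num
        _ ≤ _ := h1
        _ ≤ 4 * ((r + 1) * (r + 1)) * Nat.centralBinom h ^ 2 := by gcongr; omega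
        _ = _ := by ring
    exact_mod_cast (Nat.pow_le_pow_iff_left (by norm_num)).1 h2
  have hpow : (2 : ℝ) ^ d ≤ 16 * 4 ^ h := by
    have : (4 : ℝ) ^ h = 2 ^ (2 * h) := by rw [pow_mul]; norm_num
    rw [this, show (16 : ℝ) = 2 ^ 4 by norm_num, ← pow_add]
    exact pow_le_pow_right₀ (by norm_num) (by omega)
  have hdpos : (0 : ℝ) < d := by exact_mod_cast (show 0 < d by omega)
  have hsq : 0 < Real.sqrt d := Real.sqrt_pos.2 hdpos
  have hlog : Real.log d ≤ 2 * Real.sqrt d := by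
    have h1 := Real.log_le_sub_one_of_pos hsq
    rw [Real.log_sqrt hdpos.le] at h1
    linarith
  rw [div_le_iff₀ hsq]
  have hC : (0 : ℝ) ≤ Nat.centralBinom h := by positivity
  have h2d : (2 : ℝ) ^ d ≤ 256 * (s * (Nat.centralBinom h / 2)) := by
    have := mul_le_mul_of_nonneg_right hsr hC
    nlinarith
  have hp : (0 : ℝ) < 2 ^ d := by positivity
  calc 1 / 2048 * 2 ^ d * Real.log d ≤ 1 / 2048 * 2 ^ d * (2 * Real.sqrt d) := by gcongr
    _ = (2 ^ d / 1024) * Real.sqrt d := by ring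
    _ ≤ (s * (Nat.centralBinom h / 2)) * Real.sqrt d := by
      gcongr
      linarith
end

section
/- For every set S of 8 points in general position in ℝ^4, there are at least 4 unordered pairs {A, B} of disjoint 4-element subsets of S such that the intrinsic (relative) interiors of the convex hulls of A and of B have a common point. -/
section FC

open Finset

/-- Combinatorial core of the rotation argument. -/
lemma fc_rot : ∀ s : Fin 7 → Bool, ∃ j : Fin 7,
    (univ.filter (fun k : Fin 7 => (k < j ∧ s k = false) ∨ (j < k ∧ s k = true))).card = 3 := by
  decide +kernel

/-- `A` is the positive part of a nowhere zero dependency, and has four elements. -/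
def FCGood (W : Submodule ℝ (Fin 8 → ℝ)) (A : Finset (Fin 8)) : Prop :=
  A.card = 4 ∧ ∃ v ∈ W, ∀ k, (k ∈ A → 0 < v k) ∧ (k ∉ A → v k < 0)

lemma FCGood.compl {W : Submodule ℝ (Fin 8 → ℝ)} {A : Finset (Fin 8)} (h : FCGood W A) :
    FCGood W Aᶜ := by
  obtain ⟨hc, v, hv, h⟩ := h
  refine ⟨by rw [card_compl, hc]; rfl, -v, W.neg_mem hv, fun k => ⟨fun hk => ?_, fun hk => ?_⟩⟩
  · have := (h k).2 (by simpa using hk)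
    simpa using this
  · have := (h k).1 (by simpa using hk)
    simpa using this

lemma fc_third (i j : Fin 8) : ∃ k, k ≠ i ∧ k ≠ j := by
  revert i j; decide

lemma fc_step1 (W : Submodule ℝ (Fin 8 → ℝ))
    (h0 : ∀ v ∈ W, ∀ i j k, i ≠ j → i ≠ k → j ≠ k → v i = 0 → v j = 0 → v k = 0 → v = 0)
    (h1 : ∀ i j, ∃ v ∈ W, v ≠ 0 ∧ v i = 0 ∧ v j = 0) (i : Fin 8) :
    ∃ j, j ≠ i ∧ ∃ v ∈ W, v i = 0 ∧ v j = 0 ∧ v ≠ 0 ∧ (univ.filter (fun k => 0 < v k)).card = 3 := by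
  obtain ⟨a, hai, -⟩ := fc_third i i
  obtain ⟨b, hbi, hba⟩ := fc_third i a
  obtain ⟨u0, hu0, hu0n, hu0i, hu0a⟩ := h1 i a
  obtain ⟨v, hv, hvn, hvi, hvb⟩ := h1 i b
  have hu0' : ∀ k, k ≠ i → k ≠ a → u0 k ≠ 0 := fun k hk hka h =>
    hu0n (h0 u0 hu0 i a k hai.symm hk.symm hka.symm hu0i hu0a h)
  have hv' : ∀ k, k ≠ i → k ≠ b → v k ≠ 0 := fun k hk hka h =>
    hvn (h0 v hv i b k hbi.symm hk.symm hka.symm hvi hvb h)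
  obtain ⟨c, hc⟩ := Infinite.exists_notMem_finset (univ.image (fun k => - u0 k / v k))
  have hc' : ∀ k, c ≠ - u0 k / v k := fun k h => hc (by
    rw [h]; exact mem_image_of_mem _ (mem_univ k))
  set u : Fin 8 → ℝ := u0 + c • v with hu
  have huW : u ∈ W := W.add_mem hu0 (W.smul_mem c hv)
  have hui : u i = 0 := by simp [hu, hu0i, hvi]
  have hun : ∀ k, k ≠ i → u k ≠ 0 := by
    intro k hk h
    by_cases hkb : k = b
    · subst hkb
      have : u0 k = 0 := by simpa [hu, hvb] using h
      exact hu0' k hk hba this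
    · apply hc' k
      have := hv' k hk hkb
      field_simp
      have h2 : u0 k + c * v k = 0 := by simpa [hu] using h
      linarith
  set t : Fin 7 → ℝ := fun k => v (i.succAbove k) / u (i.succAbove k) with ht
  have htinj : Function.Injective t := by
    intro k l hkl
    by_contra hne
    have hk := hun _ (Fin.succAbove_ne i k)
    have hl := hun _ (Fin.succAbove_ne i l)
    have hz : v - t k • u = 0 := by
      apply h0 _ (W.sub_mem hv (W.smul_mem _ huW)) i (i.succAbove k) (i.succAbove l)
        (Fin.succAbove_ne i k).symm (Fin.succAbove_ne i l).symm
        (fun h => hne (Fin.succAbove_right_injective h))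
      · simp [hvi, hui]
      · simp [ht, hk]
      · rw [hkl]; simp [ht, hl]
    have hb0 : t k * u b = 0 := by
      have := congrFun hz b
      simpa [hvb] using this
    have ht0 : t k = 0 := (mul_eq_zero.1 hb0).resolve_right (hun b hbi)
    rw [ht0] at hz
    exact hvn (by simpa using hz)
  have hmono : StrictMono (t ∘ Tuple.sort t) :=
    (Tuple.monotone_sort t).strictMono_of_injective (htinj.comp (Tuple.sort t).injective)
  set e : Fin 7 → Fin 8 := fun k => i.succAbove (Tuple.sort t k) with he
  have heinj : Function.Injective e :=
    Fin.succAbove_right_injective.comp (Tuple.sort t).injective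
  have hei : ∀ k, e k ≠ i := fun k => Fin.succAbove_ne i _
  have hesurj : ∀ l, l ≠ i → ∃ k, e k = l := by
    intro l hl
    obtain ⟨m, rfl⟩ := Fin.exists_succAbove_eq hl
    exact ⟨(Tuple.sort t).symm m, by simp [he]⟩
  obtain ⟨j, hj⟩ := fc_rot (fun k => decide (0 < u (e k)))
  set T := t (Tuple.sort t j) with hT
  have hval : ∀ k, (v - T • u) (e k) = u (e k) * ((t ∘ Tuple.sort t) k - (t ∘ Tuple.sort t) j) := by
    intro k
    have hk := hun _ (hei k)
    have : t (Tuple.sort t k) * u (e k) = v (e k) := by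
      simp only [ht, he] at hk ⊢
      field_simp
    simp only [Pi.sub_apply, Pi.smul_apply, smul_eq_mul, Function.comp]
    rw [← this]; ring
  refine ⟨e j, hei j, v - T • u, W.sub_mem hv (W.smul_mem _ huW), ?_, ?_, ?_, ?_⟩
  · simp [hvi, hui]
  · rw [hval]; simp
  · intro hz
    have hb0 : T * u b = 0 := by
      have := congrFun hz b
      simpa [hvb] using this
    have ht0 : T = 0 := (mul_eq_zero.1 hb0).resolve_right (hun b hbi)
    rw [ht0] at hz
    exact hvn (by simpa using hz)
  · rw [← hj, ← card_image_of_injective _ heinj]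
    congr 1
    ext l
    simp only [mem_filter, mem_univ, true_and, mem_image]
    have key : ∀ k, 0 < (v - T • u) (e k) ↔
        ((k < j ∧ decide (0 < u (e k)) = false) ∨ (j < k ∧ decide (0 < u (e k)) = true)) := by
      intro k
      rw [hval]
      have hk := hun _ (hei k)
      rcases lt_trichotomy k j with h | h | h
      · have h2 := hmono h
        have h3 : (t ∘ Tuple.sort t) k - (t ∘ Tuple.sort t) j < 0 := by linarith
        simp only [h, h.not_gt, decide_eq_false_iff_not, not_lt,
          true_and, false_and, or_false]
        rcases lt_or_gt_of_ne hk with h4 | h4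
        · exact ⟨fun _ => h4.le, fun _ => mul_pos_of_neg_of_neg h4 h3⟩
        · exact ⟨fun h5 => absurd h5 (mul_neg_of_pos_of_neg h4 h3).not_gt, fun h5 => absurd h5 h4.not_ge⟩
      · subst h; simp
      · have h2 := hmono h
        have h3 : 0 < (t ∘ Tuple.sort t) k - (t ∘ Tuple.sort t) j := by linarith
        simp only [h, h.not_gt, decide_eq_true_eq, true_and, false_and, false_or]
        exact mul_pos_iff_of_pos_right h3
    constructor
    · intro hl
      have hli : l ≠ i := by
        rintro rfl
        simp [hvi, hui] at hl
      obtain ⟨k, rfl⟩ := hesurj l hli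
      exact ⟨k, (key k).1 hl, rfl⟩
    · rintro ⟨k, hk, rfl⟩
      exact (key k).2 hk

lemma fc_step2 (W : Submodule ℝ (Fin 8 → ℝ))
    (h0 : ∀ v ∈ W, ∀ i j k, i ≠ j → i ≠ k → j ≠ k → v i = 0 → v j = 0 → v k = 0 → v = 0)
    (h1 : ∀ i j, ∃ v ∈ W, v ≠ 0 ∧ v i = 0 ∧ v j = 0) (i j : Fin 8) (hij : i ≠ j) :
    ∃ v ∈ W, v i = 1 ∧ v j = -1 := by
  obtain ⟨k, hki, hkj⟩ := fc_third i j
  obtain ⟨a, ha, han, hai, hak⟩ := h1 i k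
  obtain ⟨b, hb, hbn, hbj, hbk⟩ := h1 j k
  have haj : a j ≠ 0 := fun h => han (h0 a ha i j k hij hki.symm hkj.symm hai h hak)
  have hbi : b i ≠ 0 := fun h => hbn (h0 b hb i j k hij hki.symm hkj.symm h hbj hbk)
  refine ⟨(b i)⁻¹ • b - (a j)⁻¹ • a, W.sub_mem (W.smul_mem _ hb) (W.smul_mem _ ha), ?_, ?_⟩
  · simp [hai, hbi]
  · simp [hbj, haj]

/-- A small perturbation preserves the signs of the nonzero coordinates. -/
lemma fc_small (l m : Fin 8 → ℝ) : ∃ ε : ℝ, 0 < ε ∧ ∀ k, l k ≠ 0 → |ε * m k| < |l k| := by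
  have h : ∀ᶠ ε in nhdsWithin (0 : ℝ) (Set.Ioi 0), ∀ k, l k ≠ 0 → |ε * m k| < |l k| := by
    rw [Filter.eventually_all]
    intro k
    by_cases hk : l k = 0
    · simp [hk]
    · have hc : Filter.Tendsto (fun ε : ℝ => |ε * m k|) (nhdsWithin (0 : ℝ) (Set.Ioi 0))
          (nhds 0) := by
        have : Continuous (fun ε : ℝ => |ε * m k|) := by fun_prop
        have h2 := this.tendsto 0
        simp only [zero_mul, abs_zero] at h2
        exact h2.mono_left nhdsWithin_le_nhds
      filter_upwards [hc.eventually_lt_const (abs_pos.2 hk)] with ε hε _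
      exact hε
  obtain ⟨ε, h1, h2⟩ := (h.and self_mem_nhdsWithin).exists
  exact ⟨ε, h2, h1⟩

lemma fc_pert (W : Submodule ℝ (Fin 8 → ℝ)) (l m : Fin 8 → ℝ) (hl : l ∈ W) (hm : m ∈ W)
    (i j : Fin 8) (hij : i ≠ j) (hli : l i = 0) (hlj : l j = 0)
    (hln : ∀ k, k ≠ i → k ≠ j → l k ≠ 0) (hmi : m i = 1) (hmj : m j = -1)
    (hc : (univ.filter (fun k => 0 < l k)).card = 3) :
    FCGood W (insert i (univ.filter (fun k => 0 < l k))) := by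
  refine ⟨by rw [card_insert_of_notMem (by simp [hli]), hc], ?_⟩
  obtain ⟨ε, he, h⟩ := fc_small l m
  refine ⟨l + ε • m, W.add_mem hl (W.smul_mem _ hm), fun k => ?_⟩
  simp only [Pi.add_apply, Pi.smul_apply, smul_eq_mul, mem_insert, mem_filter, mem_univ, true_and]
  by_cases hki : k = i
  · subst hki; simp [hli, hmi, he]
  by_cases hkj : k = j
  · subst hkj; simp [hlj, hmj, he, hki]
  have h2 := hln k hki hkj
  have h3 := h k h2
  simp only [hki, false_or]
  constructor
  · intro h4
    rw [abs_of_pos h4, abs_lt] at h3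
    linarith
  · intro h4
    have h5 : l k < 0 := lt_of_le_of_ne (not_lt.1 h4) h2
    rw [abs_of_neg h5, abs_lt] at h3
    linarith

lemma fc_swap (W : Submodule ℝ (Fin 8 → ℝ))
    (h0 : ∀ v ∈ W, ∀ i j k, i ≠ j → i ≠ k → j ≠ k → v i = 0 → v j = 0 → v k = 0 → v = 0)
    (h1 : ∀ i j, ∃ v ∈ W, v ≠ 0 ∧ v i = 0 ∧ v j = 0) (i : Fin 8) :
    ∃ j P, j ≠ i ∧ i ∉ P ∧ j ∉ P ∧ FCGood W (insert i P) ∧ FCGood W (insert j P) := by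
  obtain ⟨j, hji, l, hl, hli, hlj, hln, hc⟩ := fc_step1 W h0 h1 i
  obtain ⟨m, hm, hmi, hmj⟩ := fc_step2 W h0 h1 i j hji.symm
  have hn : ∀ k, k ≠ i → k ≠ j → l k ≠ 0 := fun k hki hkj h =>
    hln (h0 l hl i j k hji.symm hki.symm hkj.symm hli hlj h)
  refine ⟨j, univ.filter (fun k => 0 < l k), hji, by simp [hli], by simp [hlj], ?_, ?_⟩
  · exact fc_pert W l m hl hm i j hji.symm hli hlj hn hmi hmj hc
  · exact fc_pert W l (-m) hl (W.neg_mem hm) j i hji hlj hli (fun k a b => hn k b a)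
      (by simp [hmj]) (by simp [hmi]) hc

/-- The pair of indices exchanged between two bipartitions (if there is one). -/
def fcD (X Y : Finset (Fin 8)) : Finset (Fin 8) :=
  if (symmDiff X Y).card = 2 then symmDiff X Y
  else if (symmDiff X Y)ᶜ.card = 2 then (symmDiff X Y)ᶜ else ∅

lemma fcD_card (X Y : Finset (Fin 8)) : (fcD X Y).card ≤ 2 := by
  unfold fcD; split_ifs <;> simp_all

lemma fcD_self (X : Finset (Fin 8)) : fcD X X = ∅ := by
  simp [fcD]

lemma fcD_comm (X Y : Finset (Fin 8)) : fcD X Y = fcD Y X := by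
  simp only [fcD, symmDiff_comm X Y]

lemma fcD_compl (X Y : Finset (Fin 8)) : fcD Xᶜ Y = fcD X Y := by
  have h : symmDiff Xᶜ Y = (symmDiff X Y)ᶜ := by
    ext k; simp only [mem_symmDiff, mem_compl]; tauto
  have h2 := card_compl (symmDiff X Y)
  simp only [Fintype.card_fin] at h2
  simp only [fcD, h, compl_compl]
  split_ifs <;> first | rfl | omega

lemma fcD_compl' (X Y : Finset (Fin 8)) : fcD X Yᶜ = fcD X Y := by
  rw [fcD_comm, fcD_compl, fcD_comm]

lemma fcD_swap (i j : Fin 8) (P : Finset (Fin 8)) (h : j ≠ i) (hi : i ∉ P) (hj : j ∉ P) :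
    i ∈ fcD (insert i P) (insert j P) := by
  have : symmDiff (insert i P) (insert j P) = {i, j} := by
    ext k; simp only [mem_symmDiff, mem_insert, mem_singleton]
    constructor
    · tauto
    · rintro (rfl | rfl)
      · left; exact ⟨Or.inl rfl, by simp [hi, h.symm]⟩
      · right; exact ⟨Or.inl rfl, by simp [hj, h]⟩
  rw [fcD, this, if_pos (card_pair h.symm)]
  simp

open Classical in
lemma fc_count (W : Submodule ℝ (Fin 8 → ℝ))
    (h0 : ∀ v ∈ W, ∀ i j k, i ≠ j → i ≠ k → j ≠ k → v i = 0 → v j = 0 → v k = 0 → v = 0)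
    (h1 : ∀ i j, ∃ v ∈ W, v ≠ 0 ∧ v i = 0 ∧ v j = 0) :
    4 ≤ (univ.filter (fun A : Finset (Fin 8) => FCGood W A ∧ (0 : Fin 8) ∈ A)).card := by
  set G := univ.filter (fun A : Finset (Fin 8) => FCGood W A ∧ (0 : Fin 8) ∈ A) with hG
  by_contra hlt
  have hlt : G.card ≤ 3 := by omega
  obtain ⟨H, hGH, hH⟩ := Finset.exists_superset_card_eq (s := G) hlt
    (by simp [Fintype.card_finset])
  obtain ⟨X, Y, Z, -, -, -, rfl⟩ := card_eq_three.1 hH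
  have hrep : ∀ A, FCGood W A → ∃ B ∈ G, ∀ C, fcD A C = fcD B C := by
    intro A hA
    by_cases h : (0 : Fin 8) ∈ A
    · exact ⟨A, by simp [hG, hA, h], fun _ => rfl⟩
    · exact ⟨Aᶜ, by simp [hG, hA.compl, h], fun C => (fcD_compl A C).symm⟩
  have hcov : (univ : Finset (Fin 8)) ⊆ fcD X Y ∪ fcD X Z ∪ fcD Y Z := by
    intro i _
    obtain ⟨j, P, hji, hi, hj, g1, g2⟩ := fc_swap W h0 h1 i
    obtain ⟨B, hB, hB'⟩ := hrep _ g1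
    obtain ⟨C, hC, hC'⟩ := hrep _ g2
    have hi2 := fcD_swap i j P hji hi hj
    rw [hB', fcD_comm, hC', fcD_comm] at hi2
    have hB := hGH hB
    have hC := hGH hC
    simp only [mem_insert, mem_singleton] at hB hC
    simp only [mem_union]
    rcases hB with rfl | rfl | rfl <;> rcases hC with rfl | rfl | rfl <;>
      first
        | (simp [fcD_self] at hi2)
        | (simp only [hi2, true_or, or_true])
        | (rw [fcD_comm] at hi2; simp only [hi2, true_or, or_true])
  have c1 := card_le_card hcov
  have c2 := card_union_le (fcD X Y ∪ fcD X Z) (fcD Y Z)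
  have c3 := card_union_le (fcD X Y) (fcD X Z)
  have c4 := fcD_card X Y
  have c5 := fcD_card X Z
  have c6 := fcD_card Y Z
  simp only [card_univ, Fintype.card_fin] at c1
  omega

/-- A strictly positive convex combination of an affinely independent set lies in the
intrinsic interior of its convex hull. -/
lemma fc_interior {E : Type*} [NormedAddCommGroup E] [NormedSpace ℝ E] [FiniteDimensional ℝ E]
    (A : Finset E) (hA : AffineIndependent ℝ (fun p : (A : Set E) => (p : E)))
    (w : E → ℝ) (hw : ∀ a ∈ A, 0 < w a) (hw1 : ∑ a ∈ A, w a = 1) :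
    ∑ a ∈ A, w a • a ∈ intrinsicInterior ℝ (convexHull ℝ (A : Set E)) := by
  classical
  obtain ⟨t, hAt, hti, hts⟩ := exists_subset_affineIndependent_affineSpan_eq_top hA
  obtain ⟨b, hb⟩ : ∃ b : AffineBasis t ℝ E, ∀ a, b a = (a : E) :=
    ⟨⟨fun p => (p : E), hti, by simpa using hts⟩, fun _ => rfl⟩
  have hfin : Finite t := finite_of_fin_dim_affineIndependent ℝ hti
  have : Fintype t := Fintype.ofFinite t
  have hb1 : ∀ a : t, b.coord a (a : E) = 1 := fun a => by
    rw [← hb]; exact b.coord_apply_eq a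
  have hb0 : ∀ a : t, ∀ c : E, c ∈ t → c ≠ a → b.coord a c = 0 := fun a c hc hca => by
    have := b.coord_apply_ne (i := a) (j := ⟨c, hc⟩) (fun h => hca (by rw [h]))
    rwa [hb] at this
  set x := ∑ a ∈ A, w a • a with hx
  have hmem : x ∈ convexHull ℝ (A : Set E) :=
    Finset.mem_convexHull'.2 ⟨w, fun a ha => (hw a ha).le, hw1, rfl⟩
  have hcx : ∀ a : t, (a : E) ∈ A → 0 < b.coord a x := by
    intro a ha
    have hx2 : x = A.affineCombination ℝ id w := by
      rw [Finset.affineCombination_eq_linear_combination _ _ _ hw1]; rfl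
    rw [hx2, Finset.map_affineCombination _ _ _ hw1,
      Finset.affineCombination_eq_linear_combination _ _ _ hw1]
    rw [Finset.sum_eq_single_of_mem (a : E) ha]
    · simpa [hb1 a] using hw _ ha
    · intro c hc hca
      simp [hb0 a c (hAt hc) hca]
  rw [mem_intrinsicInterior]
  refine ⟨⟨x, subset_affineSpan ℝ _ hmem⟩, ?_, rfl⟩
  rw [mem_interior]
  refine ⟨{y | ∀ a : t, (a : E) ∈ A → 0 < b.coord a (y : E)}, ?_, ?_, hcx⟩
  · rintro ⟨y, hy⟩ hpos
    rw [affineSpan_convexHull] at hy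
    have hz : ∀ a : t, (a : E) ∉ A → b.coord a y = 0 := by
      intro a ha
      have hle : affineSpan ℝ (A : Set E) ≤
          (AffineSubspace.comap (b.coord a) (affineSpan ℝ ({0} : Set ℝ))) := by
        rw [affineSpan_le]
        intro c hc
        have := hb0 a c (hAt hc) (fun h => ha (by rw [← h]; exact hc))
        simpa using this
      simpa using hle hy
    have hsum := b.linear_combination_coord_eq_self y
    have hone := b.sum_coord_apply_eq_one y
    change y ∈ convexHull ℝ (A : Set E)
    have hext : ∀ a : t, b.coord a y ≠ 0 → (a : E) ∈ A := fun a h => by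
      by_contra h2
      exact h (hz a h2)
    simp only [hb] at hsum
    rw [← hsum, ← Finset.sum_filter_of_ne (p := fun a : t => (a : E) ∈ A)
      (fun a _ h => hext a (left_ne_zero_of_smul h))]
    rw [← Finset.sum_filter_of_ne (p := fun a : t => (a : E) ∈ A)
      (fun a _ h => hext a h)] at hone
    refine (convex_convexHull ℝ (A : Set E)).sum_mem ?_ hone ?_
    · intro a ha
      exact (hpos a (mem_filter.1 ha).2).le
    · intro a ha
      exact subset_convexHull ℝ _ (mem_filter.1 ha).2
  · have : {y : affineSpan ℝ (convexHull ℝ (A : Set E)) |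
        ∀ a : t, (a : E) ∈ A → 0 < b.coord a (y : E)} =
        ⋂ a : t, {y : affineSpan ℝ (convexHull ℝ (A : Set E)) | (a : E) ∈ A → 0 < b.coord a (y : E)} := by
      ext y; simp
    rw [this]
    apply isOpen_iInter_of_finite
    intro a
    by_cases ha : (a : E) ∈ A
    · simp only [ha, true_imp_iff]
      exact isOpen_lt continuous_const
        ((continuous_barycentric_coord b a).comp continuous_subtype_val)
    · simp [ha]

/-- Indexed form of `fc_interior`. -/
lemma fc_interior' {E : Type*} [NormedAddCommGroup E] [NormedSpace ℝ E] [FiniteDimensional ℝ E]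
    [DecidableEq E] (p : Fin 8 → E) (hp : Function.Injective p) (A : Finset (Fin 8))
    (hA : AffineIndependent ℝ (fun q : ((A.image p : Finset E) : Set E) => (q : E)))
    (w : Fin 8 → ℝ) (hw : ∀ a ∈ A, 0 < w a) (hw1 : ∑ a ∈ A, w a = 1) :
    ∑ a ∈ A, w a • p a ∈ intrinsicInterior ℝ (convexHull ℝ ((A.image p : Finset E) : Set E)) := by
  have hg : ∀ k, Function.invFun p (p k) = k := Function.leftInverse_invFun hp
  have := fc_interior (A.image p) hA (fun x => w (Function.invFun p x))
    (by
      intro a ha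
      obtain ⟨k, hk, rfl⟩ := mem_image.1 ha
      rw [hg]; exact hw k hk)
    (by rw [sum_image hp.injOn]; simpa [hg] using hw1)
  rw [sum_image hp.injOn] at this
  simpa only [hg] using this

lemma fc_cross {E : Type*} [NormedAddCommGroup E] [NormedSpace ℝ E] [FiniteDimensional ℝ E]
    [DecidableEq E] (p : Fin 8 → E) (hp : Function.Injective p) (A : Finset (Fin 8))
    (hne : A.Nonempty)
    (hA : AffineIndependent ℝ (fun q : ((A.image p : Finset E) : Set E) => (q : E)))
    (hB : AffineIndependent ℝ (fun q : ((Aᶜ.image p : Finset E) : Set E) => (q : E)))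
    (v : Fin 8 → ℝ) (h1 : ∑ k, v k = 0) (h2 : ∑ k, v k • p k = 0)
    (hv : ∀ k, (k ∈ A → 0 < v k) ∧ (k ∉ A → v k < 0)) :
    (intrinsicInterior ℝ (convexHull ℝ ((A.image p : Finset E) : Set E)) ∩
      intrinsicInterior ℝ (convexHull ℝ ((Aᶜ.image p : Finset E) : Set E))).Nonempty := by
  set s := ∑ k ∈ A, v k with hs
  have hspos : 0 < s := sum_pos (fun k hk => (hv k).1 hk) hne
  have e1 := sum_add_sum_compl A v
  have e2 := sum_add_sum_compl A (fun k => v k • p k)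
  rw [h1] at e1
  rw [h2] at e2
  have m1 := fc_interior' p hp A hA (fun k => v k / s) (fun k hk => div_pos ((hv k).1 hk) hspos)
    (by rw [← sum_div, ← hs, div_self hspos.ne'])
  have m2 := fc_interior' p hp Aᶜ hB (fun k => - v k / s)
    (fun k hk => div_pos (neg_pos.2 ((hv k).2 (mem_compl.1 hk))) hspos)
    (by
      rw [← sum_div, sum_neg_distrib, div_eq_one_iff_eq hspos.ne']
      linarith)
  refine ⟨_, m1, ?_⟩
  convert m2 using 1
  have a1 : ∑ a ∈ A, (v a / s) • p a = s⁻¹ • ∑ a ∈ A, v a • p a := by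
    rw [smul_sum]
    exact sum_congr rfl fun a _ => by rw [smul_smul, div_eq_inv_mul]
  have a2 : ∑ a ∈ Aᶜ, (- v a / s) • p a = s⁻¹ • (- ∑ a ∈ Aᶜ, v a • p a) := by
    rw [← sum_neg_distrib, smul_sum]
    exact sum_congr rfl fun a _ => by rw [← neg_smul, smul_smul, div_eq_inv_mul]
  rw [a1, a2, eq_neg_of_add_eq_zero_left e2]

open Classical in
lemma fc_main (S : Finset (EuclideanSpace ℝ (Fin 4))) (hS : S.card = 8) (hG : GenPos 4 S) :
    4 ≤ (crossingPairs 4 4 S).ncard := by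
  let e : Fin 8 ≃ S := (S.equivFinOfCardEq hS).symm
  obtain ⟨p, hpS, hp⟩ : ∃ p : Fin 8 → EuclideanSpace ℝ (Fin 4),
      (∀ k, p k ∈ S) ∧ Function.Injective p :=
    ⟨fun k => e k, fun k => (e k).2, Subtype.val_injective.comp e.injective⟩
  have hsub : ∀ T : Finset (Fin 8), T.image p ⊆ S := fun T => by
    intro x hx
    obtain ⟨k, -, rfl⟩ := mem_image.1 hx
    exact hpS k
  have gp : ∀ T : Finset (Fin 8), T.card ≤ 5 → AffineIndependent ℝ
      (fun q : ((T.image p : Finset _) : Set (EuclideanSpace ℝ (Fin 4))) =>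
        (q : EuclideanSpace ℝ (Fin 4))) := fun T hT =>
    hG _ (hsub T) (card_image_le.trans hT)
  have gp' : ∀ T : Finset (Fin 8), T.card ≤ 5 → AffineIndependent ℝ (fun k : T => p k) := by
    intro T hT
    have hm : ∀ k : T, p k ∈ ((T.image p : Finset _) : Set (EuclideanSpace ℝ (Fin 4))) :=
      fun k => mem_coe.2 (mem_image_of_mem p k.2)
    let f : T ↪ ((T.image p : Finset _) : Set (EuclideanSpace ℝ (Fin 4))) :=
      ⟨fun k => ⟨p k, hm k⟩, fun a b h => Subtype.ext (hp (congrArg Subtype.val h))⟩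
    exact (gp T hT).comp_embedding f
  let L : (Fin 8 → ℝ) →ₗ[ℝ] (ℝ × EuclideanSpace ℝ (Fin 4)) :=
    LinearMap.prod (Fintype.linearCombination ℝ (fun _ => (1 : ℝ))) (Fintype.linearCombination ℝ p)
  obtain ⟨W, hWL, hW⟩ : ∃ W : Submodule ℝ (Fin 8 → ℝ), W = LinearMap.ker L ∧
      ∀ v, v ∈ W ↔ ∑ k, v k = 0 ∧ ∑ k, v k • p k = 0 :=
    ⟨LinearMap.ker L, rfl, fun v => by
      simp [L, Fintype.linearCombination_apply]⟩
  have h0 : ∀ v ∈ W, ∀ i j k, i ≠ j → i ≠ k → j ≠ k → v i = 0 → v j = 0 → v k = 0 → v = 0 := by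
    intro v hv i j k hij hik hjk hi hj hk
    obtain ⟨s1, s2⟩ := (hW v).1 hv
    have hc : ({i, j, k} : Finset (Fin 8))ᶜ.card ≤ 5 := by
      rw [card_compl, card_eq_three.2 ⟨i, j, k, hij, hik, hjk, rfl⟩]; simp
    have hz : ∀ l, l ∉ ({i, j, k} : Finset (Fin 8))ᶜ → v l = 0 := by
      intro l hl
      simp only [mem_compl, not_not, mem_insert, mem_singleton] at hl
      rcases hl with rfl | rfl | rfl <;> assumption
    have := affineIndependent_iff.1 (gp' _ hc) univ (fun l => v l)
      (by
        rw [sum_coe_sort _ v, ← s1]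
        exact sum_subset (subset_univ _) fun l _ hl => hz l hl)
      (by
        rw [sum_coe_sort _ (fun l => v l • p l), ← s2]
        exact sum_subset (subset_univ _) fun l _ hl => by rw [hz l hl, zero_smul])
    ext l
    by_cases hl : l ∈ ({i, j, k} : Finset (Fin 8))ᶜ
    · exact this ⟨l, hl⟩ (mem_univ _)
    · exact hz l hl
  have h1 : ∀ i j, ∃ v ∈ W, v ≠ 0 ∧ v i = 0 ∧ v j = 0 := by
    intro i j
    let M : (Fin 8 → ℝ) →ₗ[ℝ] ((ℝ × EuclideanSpace ℝ (Fin 4)) × (ℝ × ℝ)) :=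
      LinearMap.prod L (LinearMap.prod (LinearMap.proj i) (LinearMap.proj j))
    have hk : LinearMap.ker M ≠ ⊥ := LinearMap.ker_ne_bot_of_finrank_lt (by simp)
    obtain ⟨v, hv, hvn⟩ := Submodule.exists_mem_ne_zero_of_ne_bot hk
    have hv2 : M v = 0 := hv
    have e1 : L v = 0 := congrArg Prod.fst hv2
    have e2 : v i = 0 := congrArg (fun x => x.2.1) hv2
    have e3 : v j = 0 := congrArg (fun x => x.2.2) hv2
    exact ⟨v, by rw [hWL]; exact e1, hvn, e2, e3⟩
  have hcount := fc_count W h0 h1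
  set G := univ.filter (fun A : Finset (Fin 8) => FCGood W A ∧ (0 : Fin 8) ∈ A) with hGdef
  let F : Finset (Fin 8) → Sym2 (Finset (EuclideanSpace ℝ (Fin 4))) :=
    fun A => s(A.image p, Aᶜ.image p)
  have himg : Function.Injective (fun A : Finset (Fin 8) => A.image p) := image_injective hp
  have hFinj : Set.InjOn F (G : Set (Finset (Fin 8))) := by
    intro A hA B hB hAB
    have hA0 : (0 : Fin 8) ∈ A := (mem_filter.1 hA).2.2
    have hB0 : (0 : Fin 8) ∈ B := (mem_filter.1 hB).2.2
    rcases Sym2.eq_iff.1 hAB with ⟨h, -⟩ | ⟨h, -⟩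
    · exact himg h
    · have h' : A = Bᶜ := himg h
      rw [h'] at hA0
      exact absurd hB0 (mem_compl.1 hA0)
  have hsubC : F '' (G : Set (Finset (Fin 8))) ⊆ crossingPairs 4 4 S := by
    rintro _ ⟨A, hA, rfl⟩
    obtain ⟨hc, v, hv, hvs⟩ := (mem_filter.1 hA).2.1
    have hc' : Aᶜ.card = 4 := by rw [card_compl, hc]; rfl
    obtain ⟨s1, s2⟩ := (hW v).1 hv
    refine ⟨A.image p, Aᶜ.image p, rfl, hsub _, hsub _, ?_, ?_, ?_, ?_⟩
    · exact (disjoint_image hp).2 disjoint_compl_right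
    · rw [card_image_of_injective _ hp, hc]
    · rw [card_image_of_injective _ hp, hc']
    · exact fc_cross p hp A (card_pos.1 (by omega)) (gp A (by omega)) (gp Aᶜ (by omega)) v s1 s2 hvs
  have hfin : (crossingPairs 4 4 S).Finite := by
    apply Set.Finite.subset (S.powerset.sym2).finite_toSet
    rintro _ ⟨A, B, rfl, hA, hB, -⟩
    simp [hA, hB]
  calc 4 ≤ G.card := hcount
    _ = (F '' (G : Set (Finset (Fin 8)))).ncard := by
      rw [hFinj.ncard_image, Set.ncard_coe_finset]
    _ ≤ _ := Set.ncard_le_ncard hsubC hfin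

end FC

theorem four_crossings_of_eight_points :
    ∀ S : Finset (EuclideanSpace ℝ (Fin 4)), S.card = 8 → GenPos 4 S →
      4 ≤ (crossingPairs 4 4 S).ncard := by
  exact fun S hS hG => fc_main S hS hG
end

section
/- For every integer n ≥ 8 and every set S of n points in general position in ℝ^4, the number of unordered pairs {A, B} of disjoint 4-element subsets of S such that the intrinsic (relative) interiors of the convex hulls of A and of B have a common point is at least 4 · C(n, 8), where C(n, 8) is the binomial coefficient. -/
lemma pos_comb_mem_intrinsicInterior {E : Type*} [NormedAddCommGroup E] [NormedSpace ℝ E]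
    [FiniteDimensional ℝ E] (A : Finset E)
    (hA : AffineIndependent ℝ (fun p : (A : Set E) => (p : E))) (w : E → ℝ)
    (hw : ∀ a ∈ A, 0 < w a) (hs : ∑ a ∈ A, w a = 1) :
    ∑ a ∈ A, w a • a ∈ intrinsicInterior ℝ (convexHull ℝ (A : Set E)) := by
  classical
  obtain ⟨t, hAt, ht, htop⟩ := exists_subset_affineIndependent_affineSpan_eq_top hA
  let b : AffineBasis t ℝ E := ⟨(↑), ht, by simpa using htop⟩
  have hb : ∀ i : t, b i = i := fun _ => rfl
  have key : ∀ (u : E → ℝ), ∑ a ∈ A, u a = 1 → ∀ a (ha : a ∈ A),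
      b.coord ⟨a, hAt ha⟩ (∑ a ∈ A, u a • a) = u a := by
    intro u hu a ha
    have h1 := A.affineCombination_eq_linear_combination (k := ℝ) (fun x : E => x) u hu
    rw [← h1, Finset.map_affineCombination _ _ _ hu,
      Finset.affineCombination_eq_linear_combination _ _ _ hu]
    rw [Finset.sum_eq_single a]
    · have := b.coord_apply_eq ⟨a, hAt ha⟩
      rw [hb] at this
      simp [this]
    · intro c hc hca
      have := b.coord_apply_ne (i := ⟨a, hAt ha⟩) (j := ⟨c, hAt hc⟩) (by simpa using hca.symm)
      rw [hb] at this
      simp [this]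
    · intro h; exact absurd ha h
  have hcomb : ∀ u : E → ℝ, (∀ a ∈ A, 0 < u a) → ∑ a ∈ A, u a = 1 →
      ∑ a ∈ A, u a • a ∈ convexHull ℝ (A : Set E) := by
    intro u hu hu1
    exact (convex_convexHull ℝ _).sum_mem (fun i hi => (hu i hi).le) hu1
      (fun i hi => subset_convexHull ℝ _ hi)
  rw [mem_intrinsicInterior]
  have hx := hcomb w hw hs
  refine ⟨⟨_, subset_affineSpan ℝ _ hx⟩, ?_, rfl⟩
  rw [mem_interior]
  refine ⟨{y | ∀ a : A, 0 < b.coord ⟨a, hAt a.2⟩ (y : E)}, ?_, ?_, ?_⟩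
  · rintro ⟨y, hy⟩ hpos
    simp only [Set.mem_ofPred_eq] at hpos
    rw [affineSpan_convexHull] at hy
    have hy' : y ∈ affineSpan ℝ (Set.range (fun a : A => (a : E))) := by
      have e : Set.range (fun a : A => (a : E)) = (A : Set E) := by ext; simp
      rw [e]; exact hy
    obtain ⟨v, hv1, hv⟩ := eq_affineCombination_of_mem_affineSpan_of_fintype hy'
    rw [Finset.affineCombination_eq_linear_combination _ _ _ hv1] at hv
    let u : E → ℝ := fun x => if h : x ∈ A then v ⟨x, h⟩ else 0
    have e1 : ∑ a ∈ A, u a = 1 := by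
      rw [← hv1, ← Finset.sum_coe_sort A]
      simp [u]
    have e2 : ∑ a ∈ A, u a • a = y := by
      rw [hv, ← Finset.sum_coe_sort A]
      simp [u]
    change y ∈ convexHull ℝ (A : Set E)
    rw [← e2]
    apply hcomb _ _ e1
    intro a ha
    rw [← key u e1 a ha, e2]
    exact hpos ⟨a, ha⟩
  · rw [Set.ofPred_forall]
    refine isOpen_iInter_of_finite fun a => ?_
    exact isOpen_lt continuous_const
      ((b.coord ⟨a, hAt a.2⟩).continuous_of_finiteDimensional.comp continuous_subtype_val)
  · intro a
    simp only
    rw [key w hs a a.2]; exact hw a a.2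
lemma isOpen_four_le (K : Submodule ℝ (Fin 8 → ℝ)) (c : ℝ) :
    IsOpen {x : K | 4 ≤ (Finset.univ.filter fun k => 0 < c * x.1 k).card} := by
  have e : {x : K | 4 ≤ (Finset.univ.filter fun k => 0 < c * x.1 k).card} =
      ⋃ s : {s : Finset (Fin 8) // 4 ≤ s.card}, ⋂ k : s.1, {x : K | 0 < c * x.1 k} := by
    ext x
    simp only [Set.mem_ofPred_eq, Set.mem_iUnion, Set.mem_iInter]
    constructor
    · intro h
      exact ⟨⟨_, h⟩, fun k => (Finset.mem_filter.1 k.2).2⟩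
    · rintro ⟨s, hs⟩
      refine s.2.trans (Finset.card_le_card ?_)
      intro k hk
      simpa using hs ⟨k, hk⟩
  rw [e]
  refine isOpen_iUnion fun s => isOpen_iInter_of_finite fun k => ?_
  exact isOpen_lt continuous_const
    (continuous_const.mul ((continuous_apply k.1).comp continuous_subtype_val))

lemma card_trichotomy (x : Fin 8 → ℝ) :
    (Finset.univ.filter fun k => 0 < x k).card + (Finset.univ.filter fun k => x k < 0).card
      + (Finset.univ.filter fun k => x k = 0).card = 8 := by
  classical
  rw [← Finset.card_union_of_disjoint, ← Finset.card_union_of_disjoint]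
  · convert Finset.card_fin 8
    ext k
    simp only [Finset.mem_union, Finset.mem_filter, Finset.mem_univ, true_and, iff_true]
    rcases lt_trichotomy (x k) 0 with h | h | h <;> simp [h]
  · rw [Finset.disjoint_left]
    intro k; simp only [Finset.mem_union, Finset.mem_filter, Finset.mem_univ, true_and]
    rintro (h | h)
    · exact h.ne'
    · exact h.ne
  · rw [Finset.disjoint_left]
    intro k; simp only [Finset.mem_filter, Finset.mem_univ, true_and]
    intro h; exact h.le.not_gt

section Seps

variable {F : Type*} [AddCommGroup F] [Module ℝ F] [FiniteDimensional ℝ F]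

lemma exists_halving (hF : Module.finrank ℝ F = 5) (Φ : (Fin 8 → ℝ) →ₗ[ℝ] F)
    (H : ∀ x, Φ x = 0 → 3 ≤ (Finset.univ.filter fun k => x k = 0).card → x = 0) (i : Fin 8) :
    ∃ j, j ≠ i ∧ ∃ x, Φ x = 0 ∧ (∀ k, x k = 0 ↔ k = i ∨ k = j) ∧
      (Finset.univ.filter fun k => 0 < x k).card = 3 := by
  classical
  let L := Φ.prod (LinearMap.proj (R := ℝ) (φ := fun _ : Fin 8 => ℝ) i)
  have hK : 1 < Module.rank ℝ (LinearMap.ker L) := by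
    have h1 := L.finrank_range_add_finrank_ker
    have h2 := Submodule.finrank_le (LinearMap.range L)
    rw [Module.finrank_prod, hF] at h2
    simp at h1 h2
    rw [← Module.finrank_eq_rank]
    exact_mod_cast (by omega : 1 < Module.finrank ℝ (LinearMap.ker L))
  have hmem : ∀ x, x ∈ LinearMap.ker L ↔ Φ x = 0 ∧ x i = 0 := by
    intro x; simp [L, LinearMap.mem_ker]
  have hconn := isConnected_compl_singleton_of_one_lt_rank hK 0
  by_contra hcon
  have hcover : ∀ x ∈ LinearMap.ker L, x ≠ 0 →
      4 ≤ (Finset.univ.filter fun k => 0 < x k).card ∨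
      4 ≤ (Finset.univ.filter fun k => x k < 0).card := by
    intro x hx hx0
    by_contra hlt
    push Not at hlt
    obtain ⟨hx1, hx2⟩ := (hmem x).1 hx
    have h8 := card_trichotomy x
    have hz : (Finset.univ.filter fun k => x k = 0).card < 3 := by
      by_contra h; exact hx0 (H x hx1 (by omega))
    have hz2 : (Finset.univ.filter fun k => x k = 0).card = 2 := by omega
    have hi : i ∈ (Finset.univ.filter fun k => x k = 0) := by simpa using hx2
    obtain ⟨j, hj, hji⟩ := Finset.exists_mem_ne (by omega :
      1 < (Finset.univ.filter fun k => x k = 0).card) i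
    have hset : {i, j} = (Finset.univ.filter fun k => x k = 0) := by
      apply Finset.eq_of_subset_of_card_le
      · intro k hk; simp only [Finset.mem_insert, Finset.mem_singleton] at hk
        rcases hk with rfl | rfl <;> assumption
      · rw [hz2, Finset.card_pair hji.symm]
    refine hcon ⟨j, hji, x, hx1, fun k => ?_, by omega⟩
    have : k ∈ ({i, j} : Finset (Fin 8)) ↔ k ∈ (Finset.univ.filter fun k => x k = 0) := by rw [hset]
    simpa using this.symm
  have e1 : ∀ x : Fin 8 → ℝ, (Finset.univ.filter fun k => 0 < (1 : ℝ) * x k) =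
    (Finset.univ.filter fun k => 0 < x k) := by intro x; simp
  have e2 : ∀ x : Fin 8 → ℝ, (Finset.univ.filter fun k => 0 < (-1 : ℝ) * x k) =
    (Finset.univ.filter fun k => x k < 0) := by intro x; simp
  have hU := isOpen_four_le (LinearMap.ker L) 1
  have hV := isOpen_four_le (LinearMap.ker L) (-1)
  simp only [e1] at hU
  simp only [e2] at hV
  have hne : ∃ y : LinearMap.ker L, y ≠ 0 ∧
      4 ≤ (Finset.univ.filter fun k => 0 < y.1 k).card := by
    obtain ⟨y, hy⟩ := hconn.nonempty
    have hy0 : y ≠ 0 := hy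
    rcases hcover y.1 y.2 (by simpa using hy0) with h | h
    · exact ⟨y, hy0, h⟩
    · exact ⟨-y, by simpa using hy0, by simpa using h⟩
  obtain ⟨y, hy0, hy⟩ := hne
  obtain ⟨z, hz0, hz1, hz2⟩ := hconn.isPreconnected _ _ hU hV
    (fun x hx => hcover x.1 x.2 (by simpa using hx))
    ⟨y, hy0, hy⟩ ⟨-y, by simpa using hy0, by simpa using hy⟩
  have h8 := card_trichotomy z.1
  simp only [Set.mem_ofPred_eq] at hz1 hz2
  have : 0 < (Finset.univ.filter fun k => z.1 k = 0).card :=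
    Finset.card_pos.2 ⟨i, by simpa using ((hmem z.1).1 z.2).2⟩
  omega

lemma exists_single (hF : Module.finrank ℝ F = 5) (Φ : (Fin 8 → ℝ) →ₗ[ℝ] F)
    (H : ∀ x, Φ x = 0 → 3 ≤ (Finset.univ.filter fun k => x k = 0).card → x = 0)
    (i j : Fin 8) (hij : i ≠ j) : ∃ x, Φ x = 0 ∧ x j = 0 ∧ x i = 1 := by
  classical
  obtain ⟨k, hk⟩ : ∃ k, k ∉ ({i, j} : Finset (Fin 8)) := by
    by_contra! h
    have := Finset.card_le_card (fun k _ => h k : Finset.univ ⊆ ({i, j} : Finset (Fin 8)))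
    have h2 := Finset.card_le_two (a := i) (b := j)
    simp at this; omega
  simp only [Finset.mem_insert, Finset.mem_singleton, not_or] at hk
  let L := Φ.prod ((LinearMap.proj (R := ℝ) (φ := fun _ : Fin 8 => ℝ) j).prod
    (LinearMap.proj (R := ℝ) (φ := fun _ : Fin 8 => ℝ) k))
  have hK : LinearMap.ker L ≠ ⊥ := by
    apply LinearMap.ker_ne_bot_of_finrank_lt
    rw [Module.finrank_prod, hF]
    simp
  obtain ⟨x, hx, hx0⟩ := Submodule.exists_mem_ne_zero_of_ne_bot hK
  obtain ⟨h1, h2, h3⟩ : Φ x = 0 ∧ x j = 0 ∧ x k = 0 := by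
    simpa [L, LinearMap.mem_ker] using hx
  have hxi : x i ≠ 0 := by
    intro h
    apply hx0 (H x h1 _)
    have : ({i, j, k} : Finset (Fin 8)).card = 3 := by
      rw [Finset.card_eq_three]; exact ⟨i, j, k, hij, Ne.symm hk.1, Ne.symm hk.2, rfl⟩
    rw [← this]
    apply Finset.card_le_card
    intro l hl
    simp only [Finset.mem_insert, Finset.mem_singleton] at hl
    rcases hl with rfl | rfl | rfl <;> simpa
  exact ⟨(x i)⁻¹ • x, by simp [h1], by simp [h2], by simp [hxi]⟩

/-- `A` is the positive part of a nowhere zero dependency with four positive entries. -/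
def IsSep (Φ : (Fin 8 → ℝ) →ₗ[ℝ] F) (A : Finset (Fin 8)) : Prop :=
  A.card = 4 ∧ ∃ x, Φ x = 0 ∧ (∀ k ∈ A, 0 < x k) ∧ ∀ k ∉ A, x k < 0

lemma IsSep.compl {Φ : (Fin 8 → ℝ) →ₗ[ℝ] F} {A : Finset (Fin 8)} (h : IsSep Φ A) :
    IsSep Φ Aᶜ := by
  obtain ⟨h4, x, hx, h1, h2⟩ := h
  refine ⟨by rw [Finset.card_compl, h4]; rfl, -x, by simp [hx], ?_, ?_⟩
  · intro k hk; simpa using h2 k (by simpa using hk)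
  · intro k hk; simpa using h1 k (by simpa using hk)

lemma sep_perturb (hF : Module.finrank ℝ F = 5) (Φ : (Fin 8 → ℝ) →ₗ[ℝ] F)
    (H : ∀ x, Φ x = 0 → 3 ≤ (Finset.univ.filter fun k => x k = 0).card → x = 0)
    (i j : Fin 8) (hij : i ≠ j) (x : Fin 8 → ℝ) (hx : Φ x = 0)
    (hx0 : ∀ k, x k = 0 ↔ k = i ∨ k = j)
    (h3 : (Finset.univ.filter fun k => 0 < x k).card = 3) :
    IsSep Φ (insert i (Finset.univ.filter fun k => 0 < x k)) := by
  obtain ⟨a, ha, haj, hai⟩ := exists_single hF Φ H i j hij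
  obtain ⟨b, hb, hbi, hbj⟩ := exists_single hF Φ H j i hij.symm
  have hxi : x i = 0 := (hx0 i).2 (Or.inl rfl)
  have hxj : x j = 0 := (hx0 j).2 (Or.inr rfl)
  have hev : ∀ k, ∀ᶠ ε : ℝ in nhds 0, x k ≠ 0 → 0 < x k * (x k + ε * (a k - b k)) := by
    intro k
    by_cases hk : x k = 0
    · simp [hk]
    · have hc : ContinuousAt (fun ε : ℝ => x k * (x k + ε * (a k - b k))) 0 := by fun_prop
      have := hc.eventually (lt_mem_nhds (a := 0) (by simpa using hk))
      filter_upwards [this] with ε h _ using h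
  have hev2 := (Filter.eventually_all.2 hev).filter_mono (nhdsWithin_le_nhds (s := Set.Ioi 0))
  obtain ⟨ε, hε, hpos⟩ := (hev2.and self_mem_nhdsWithin).exists
  have hpos : 0 < ε := hpos
  refine ⟨by rw [Finset.card_insert_of_notMem (by simp [hxi]), h3], x + ε • (a - b), ?_, ?_, ?_⟩
  · simp [hx, ha, hb]
  · intro k hk
    simp only [Finset.mem_insert, Finset.mem_filter, Finset.mem_univ, true_and] at hk
    rcases hk with rfl | hk
    · simp [hxi, hai, hbi, hpos]
    · exact pos_of_mul_pos_right (by simpa using hε k hk.ne') hk.le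
  · intro k hk
    simp only [Finset.mem_insert, Finset.mem_filter, Finset.mem_univ, true_and, not_or] at hk
    by_cases hkj : k = j
    · subst hkj; simp [hxj, haj, hbj, hpos]
    · have hne : x k ≠ 0 := fun h => by rcases (hx0 k).1 h with h | h <;> [exact hk.1 h; exact hkj h]
      have hlt : x k < 0 := lt_of_le_of_ne (not_lt.1 hk.2) hne
      have := hε k hne
      simp only [Pi.add_apply, Pi.smul_apply, Pi.sub_apply, smul_eq_mul]
      exact neg_of_mul_pos_right this hlt.le

lemma exists_sep_swap (hF : Module.finrank ℝ F = 5) (Φ : (Fin 8 → ℝ) →ₗ[ℝ] F)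
    (H : ∀ x, Φ x = 0 → 3 ≤ (Finset.univ.filter fun k => x k = 0).card → x = 0) (i : Fin 8) :
    ∃ j, j ≠ i ∧ ∃ A B, IsSep Φ A ∧ IsSep Φ B ∧ symmDiff A B = {i, j} := by
  obtain ⟨j, hji, x, hx, hx0, h3⟩ := exists_halving hF Φ H i
  refine ⟨j, hji, _, _, sep_perturb hF Φ H i j hji.symm x hx hx0 h3,
    sep_perturb hF Φ H j i hji x hx (fun k => by rw [hx0, or_comm]) h3, ?_⟩
  have hxi : x i = 0 := (hx0 i).2 (Or.inl rfl)
  have hxj : x j = 0 := (hx0 j).2 (Or.inr rfl)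
  ext k
  simp only [Finset.mem_symmDiff, Finset.mem_insert, Finset.mem_filter, Finset.mem_univ, true_and,
    Finset.mem_singleton]
  have := hji
  by_cases h1 : k = i
  · subst h1; simp [hxi, hji.symm]
  · by_cases h2 : k = j
    · subst h2; simp [hxj, hji]
    · simp [h1, h2]

/-- The pair of indices in which two separations differ, up to complement. -/
def swapPair (P Q : Finset (Fin 8)) : Finset (Fin 8) :=
  if (symmDiff P Q).card = 2 then symmDiff P Q
  else if ((symmDiff P Q)ᶜ).card = 2 then (symmDiff P Q)ᶜ else ∅

lemma swapPair_card (P Q : Finset (Fin 8)) : (swapPair P Q).card ≤ 2 := by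
  unfold swapPair; split_ifs <;> simp_all

lemma swapPair_comm (P Q : Finset (Fin 8)) : swapPair P Q = swapPair Q P := by
  unfold swapPair; rw [symmDiff_comm]

lemma swapPair_self (P : Finset (Fin 8)) : swapPair P P = ∅ := by
  unfold swapPair; simp

lemma swapPair_of {P Q : Finset (Fin 8)} (h : (symmDiff P Q).card = 2) :
    swapPair P Q = symmDiff P Q := by unfold swapPair; simp [h]

lemma swapPair_compl_right (P Q : Finset (Fin 8)) : swapPair P Qᶜ = swapPair P Q := by
  have e : symmDiff P Qᶜ = (symmDiff P Q)ᶜ := by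
    ext k; simp [Finset.mem_symmDiff]; tauto
  unfold swapPair; rw [e, compl_compl]
  have := Finset.card_add_card_compl (symmDiff P Q)
  simp only [Fintype.card_fin] at this
  split_ifs <;> first | rfl | omega

lemma swapPair_compl_left (P Q : Finset (Fin 8)) : swapPair Pᶜ Q = swapPair P Q := by
  rw [swapPair_comm, swapPair_compl_right, swapPair_comm]

lemma four_le_of_swaps (S : Finset (Finset (Fin 8)))
    (h : ∀ i, ∃ P ∈ S, ∃ Q ∈ S, i ∈ swapPair P Q) : 4 ≤ S.card := by
  by_contra! hlt
  obtain ⟨T, hST, hT⟩ := Finset.exists_superset_card_eq (s := S) (n := 3) (by omega)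
    (by simp)
  obtain ⟨a, b, c, -, -, -, rfl⟩ := Finset.card_eq_three.1 hT
  have hsub : (Finset.univ : Finset (Fin 8)) ⊆ swapPair a b ∪ (swapPair a c ∪ swapPair b c) := by
    intro i _
    obtain ⟨P, hP, Q, hQ, hi⟩ := h i
    have hP := hST hP
    have hQ := hST hQ
    simp only [Finset.mem_insert, Finset.mem_singleton] at hP hQ
    simp only [Finset.mem_union]
    rcases hP with rfl | rfl | rfl <;> rcases hQ with rfl | rfl | rfl <;>
      first
      | (rw [swapPair_self] at hi; simp at hi)
      | tauto
      | (rw [swapPair_comm] at hi; tauto)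
  have h1 := Finset.card_le_card hsub
  have h2 := Finset.card_union_le (swapPair a b) (swapPair a c ∪ swapPair b c)
  have h3 := Finset.card_union_le (swapPair a c) (swapPair b c)
  have := swapPair_card a b
  have := swapPair_card a c
  have := swapPair_card b c
  simp at h1
  omega

lemma four_seps (hF : Module.finrank ℝ F = 5) (Φ : (Fin 8 → ℝ) →ₗ[ℝ] F)
    (H : ∀ x, Φ x = 0 → 3 ≤ (Finset.univ.filter fun k => x k = 0).card → x = 0) :
    ∃ S : Finset (Finset (Fin 8)), 4 ≤ S.card ∧ ∀ A ∈ S, 0 ∈ A ∧ IsSep Φ A := by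
  classical
  refine ⟨Finset.univ.filter fun A => 0 ∈ A ∧ IsSep Φ A, four_le_of_swaps _ ?_, by simp⟩
  intro i
  obtain ⟨j, hji, A, B, hA, hB, hAB⟩ := exists_sep_swap hF Φ H i
  have hi : i ∈ swapPair A B := by
    rw [swapPair_of (by rw [hAB, Finset.card_pair hji.symm]), hAB]; simp
  have norm : ∀ A, IsSep Φ A → ∃ P, (0 ∈ P ∧ IsSep Φ P) ∧ (P = A ∨ P = Aᶜ) := by
    intro A hA
    by_cases h : 0 ∈ A
    · exact ⟨A, ⟨h, hA⟩, Or.inl rfl⟩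
    · exact ⟨Aᶜ, ⟨by simpa using h, hA.compl⟩, Or.inr rfl⟩
  obtain ⟨P, hP, hPA⟩ := norm A hA
  obtain ⟨Q, hQ, hQB⟩ := norm B hB
  refine ⟨P, by simpa using hP, Q, by simpa using hQ, ?_⟩
  rcases hPA with rfl | rfl <;> rcases hQB with rfl | rfl <;>
    simpa [swapPair_compl_left, swapPair_compl_right] using hi

end Seps

abbrev E4 := EuclideanSpace ℝ (Fin 4)

/-- The linear map whose kernel consists of the affine dependencies of `p`. -/
noncomputable def depMap (p : Fin 8 ↪ E4) : (Fin 8 → ℝ) →ₗ[ℝ] ℝ × E4 where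
  toFun x := (∑ k, x k, ∑ k, x k • p k)
  map_add' x y := by simp [Finset.sum_add_distrib, add_smul]
  map_smul' c x := by simp [Finset.mul_sum, Finset.smul_sum, mul_smul]

lemma depMap_eq_zero {p : Fin 8 ↪ E4} {x : Fin 8 → ℝ} :
    depMap p x = 0 ↔ ∑ k, x k = 0 ∧ ∑ k, x k • p k = 0 := by
  simp [depMap]

lemma finrank_target : Module.finrank ℝ (ℝ × E4) = 5 := by
  rw [Module.finrank_prod]; simp

lemma depMap_generic (p : Fin 8 ↪ E4) (hp : GenPos 4 (Finset.univ.map p)) (x : Fin 8 → ℝ)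
    (hx : depMap p x = 0) (h3 : 3 ≤ (Finset.univ.filter fun k => x k = 0).card) : x = 0 := by
  classical
  obtain ⟨h1, h2⟩ := depMap_eq_zero.1 hx
  set N := Finset.univ.filter fun k => x k ≠ 0 with hN
  have hc : N.card ≤ 5 := by
    have := Finset.card_filter_add_card_filter_not (s := (Finset.univ : Finset (Fin 8)))
      (fun k => x k = 0)
    simp only [Finset.card_univ, Fintype.card_fin] at this
    change _ + N.card = 8 at this
    omega
  have hind := hp (N.map p) (Finset.map_subset_map.2 (Finset.subset_univ _)) (by simpa using hc)
  let f : N ↪ ((N.map p : Finset E4) : Set E4) :=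
    ⟨fun k => ⟨p k, Finset.mem_coe.2 (Finset.mem_map_of_mem p k.2)⟩, fun a b h =>
      Subtype.ext (p.injective (congrArg Subtype.val h))⟩
  have hind2 := hind.comp_embedding f
  rw [affineIndependent_iff] at hind2
  have := hind2 Finset.univ (fun k => x k)
    (by
      rw [Finset.sum_coe_sort N (fun k => x k), hN, Finset.sum_filter_ne_zero, h1])
    (by
      change ∑ e : N, x e • p e = 0
      rw [Finset.sum_coe_sort N (fun k => x k • p k), ← h2]
      refine Finset.sum_subset (Finset.subset_univ _) ?_
      intro k _ hk
      have : x k = 0 := by simpa [hN] using hk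
      simp [this])
  ext k
  by_contra hk
  exact hk (this ⟨k, by simpa [hN] using hk⟩ (Finset.mem_univ _))

lemma pos_comb_map (p : Fin 8 ↪ E4) (hp : GenPos 4 (Finset.univ.map p)) (A : Finset (Fin 8))
    (hA : A.card = 4) (w : Fin 8 → ℝ) (hw : ∀ k ∈ A, 0 < w k) :
    (∑ k ∈ A, w k)⁻¹ • ∑ k ∈ A, w k • p k ∈
      intrinsicInterior ℝ (convexHull ℝ ((A.map p : Finset E4) : Set E4)) := by
  have hpos : 0 < ∑ k ∈ A, w k := Finset.sum_pos hw (Finset.card_pos.1 (by omega))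
  have := pos_comb_mem_intrinsicInterior (A.map p)
    (hp _ (Finset.map_subset_map.2 (Finset.subset_univ _)) (by simp [hA]))
    (Function.extend p (fun k => (∑ k ∈ A, w k)⁻¹ * w k) 0)
    (by
      intro a ha
      obtain ⟨k, hk, rfl⟩ := Finset.mem_map.1 ha
      rw [p.injective.extend_apply]
      exact mul_pos (inv_pos.2 hpos) (hw k hk))
    (by
      rw [Finset.sum_map]
      simp only [p.injective.extend_apply]
      rw [← Finset.mul_sum, inv_mul_cancel₀ hpos.ne'])
  rw [Finset.sum_map] at this
  simp only [p.injective.extend_apply] at this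
  rw [Finset.smul_sum]
  simpa only [mul_smul] using this

lemma sep_crossing (p : Fin 8 ↪ E4) (hp : GenPos 4 (Finset.univ.map p)) (A : Finset (Fin 8))
    (hA : IsSep (depMap p) A) :
    (intrinsicInterior ℝ (convexHull ℝ ((A.map p : Finset E4) : Set E4)) ∩
      intrinsicInterior ℝ (convexHull ℝ ((Aᶜ.map p : Finset E4) : Set E4))).Nonempty := by
  have hAc := hA.compl.1
  obtain ⟨h4, x, hx, h1, h2⟩ := hA
  obtain ⟨hs, hv⟩ := depMap_eq_zero.1 hx
  rw [← Finset.sum_add_sum_compl A] at hs hv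
  have q1 := pos_comb_map p hp A h4 x h1
  have q2 := pos_comb_map p hp Aᶜ hAc (fun k => -x k) (fun k hk => by
    have := h2 k (by simpa using hk)
    linarith)
  have e1 : ∑ k ∈ Aᶜ, -x k = ∑ k ∈ A, x k := by rw [Finset.sum_neg_distrib]; linarith
  have e2 : ∑ k ∈ Aᶜ, -x k • p k = ∑ k ∈ A, x k • p k := by
    simp only [neg_smul]
    rw [Finset.sum_neg_distrib]
    exact (eq_neg_of_add_eq_zero_left hv).symm
  rw [e1, e2] at q2
  exact ⟨_, q1, q2⟩

lemma four_in_eight (T : Finset E4) (hT : T.card = 8) (hG : GenPos 4 T) :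
    ∃ C : Finset (Sym2 (Finset E4)), 4 ≤ C.card ∧ ∀ q ∈ C, q ∈ crossingPairs 4 4 T ∧
      ∃ A B, q = s(A, B) ∧ A ∪ B = T := by
  classical
  let p : Fin 8 ↪ E4 := (T.equivFinOfCardEq hT).symm.toEmbedding.trans (Function.Embedding.subtype _)
  have hpT : Finset.univ.map p = T := by
    ext e
    simp only [Finset.mem_map, Finset.mem_univ, true_and]
    constructor
    · rintro ⟨k, rfl⟩; exact ((T.equivFinOfCardEq hT).symm k).2
    · intro he
      exact ⟨T.equivFinOfCardEq hT ⟨e, he⟩, by simp [p]⟩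
  have hp : GenPos 4 (Finset.univ.map p) := by rw [hpT]; exact hG
  obtain ⟨S, hS, hSep⟩ := four_seps finrank_target (depMap p) (depMap_generic p hp)
  refine ⟨S.image fun A => s(A.map p, Aᶜ.map p), ?_, ?_⟩
  · rw [Finset.card_image_of_injOn]
    · exact hS
    · intro A hA B hB hAB
      simp only [Sym2.eq_iff] at hAB
      rcases hAB with ⟨h, -⟩ | ⟨h, -⟩
      · exact Finset.map_injective p h
      · have h := Finset.map_injective p h
        have h0 := (hSep A hA).1
        rw [h] at h0
        exact absurd (hSep B hB).1 (by simpa using h0)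
  · intro q hq
    obtain ⟨A, hA, rfl⟩ := Finset.mem_image.1 hq
    have hsep := (hSep A hA).2
    have hu : A.map p ∪ Aᶜ.map p = T := by
      rw [← Finset.map_union, Finset.union_compl, hpT]
    refine ⟨⟨_, _, rfl, ?_, ?_, ?_, ?_, ?_, sep_crossing p hp A hsep⟩, _, _, rfl, hu⟩
    · rw [← hu]; exact Finset.subset_union_left
    · rw [← hu]; exact Finset.subset_union_right
    · rw [Finset.disjoint_map]; exact disjoint_compl_right
    · rw [Finset.card_map, hsep.1]
    · rw [Finset.card_map, hsep.compl.1]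

lemma crossingPairs_finite (S : Finset E4) : (crossingPairs 4 4 S).Finite := by
  classical
  refine ((S.powerset ×ˢ S.powerset).image fun a => s(a.1, a.2)).finite_toSet.subset ?_
  rintro q ⟨A, B, rfl, hA, hB, -⟩
  simp only [Finset.coe_image, Set.mem_image]
  exact ⟨(A, B), by simp [hA, hB], rfl⟩

theorem crossing_lower_bound_dim_four :
    ∀ n : ℕ, 8 ≤ n → ∀ S : Finset (EuclideanSpace ℝ (Fin 4)), S.card = n → GenPos 4 S →
      4 * n.choose 8 ≤ (crossingPairs 4 4 S).ncard := by
  classical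
  intro n _ S hS hG
  have hfin := crossingPairs_finite S
  rw [Set.ncard_eq_toFinset_card _ hfin]
  let u : Sym2 (Finset E4) → Finset E4 := Sym2.lift ⟨fun A B => A ∪ B, Finset.union_comm⟩
  have hu : ∀ A B, u s(A, B) = A ∪ B := fun _ _ => rfl
  have hmaps : Set.MapsTo u (hfin.toFinset : Set _) (S.powersetCard 8 : Set (Finset E4)) := by
    intro q hq
    have hq : q ∈ crossingPairs 4 4 S := by simpa using hq
    obtain ⟨A, B, rfl, hA, hB, hd, hA4, hB4, -⟩ := hq
    rw [hu, Finset.mem_coe, Finset.mem_powersetCard]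
    exact ⟨Finset.union_subset hA hB, by rw [Finset.card_union_of_disjoint hd, hA4, hB4]⟩
  rw [Finset.card_eq_sum_card_fiberwise hmaps, mul_comm, ← hS, ← Finset.card_powersetCard,
    ← smul_eq_mul]
  apply Finset.card_nsmul_le_sum
  intro T hT
  obtain ⟨hTS, hT8⟩ := Finset.mem_powersetCard.1 hT
  obtain ⟨C, hC, hCq⟩ := four_in_eight T hT8 (fun R hR => hG R (hR.trans hTS))
  refine hC.trans (Finset.card_le_card ?_)
  intro q hq
  obtain ⟨hq1, A, B, rfl, hAB⟩ := hCq q hq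
  rw [Finset.mem_filter, Set.Finite.mem_toFinset]
  refine ⟨?_, hAB⟩
  obtain ⟨A', B', h, hA, hB, hrest⟩ := hq1
  exact ⟨A', B', h, hA.trans hTS, hB.trans hTS, hrest⟩
end

section
/- Let S be a finite set of points in general position in ℝ^d, and let A, B ⊆ S be disjoint subsets such that the intrinsic (relative) interiors of the convex hulls of A and of B have a common point. Then for all subsets A', B' ⊆ S with A ⊆ A', B ⊆ B', A' ∩ B' = ∅, |A'| ≤ d and |B'| ≤ d, the intrinsic (relative) interiors of the convex hulls of A' and of B' also have a common point. -/
section helpers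
variable {E : Type*} [NormedAddCommGroup E] [NormedSpace ℝ E]

theorem ce_span_coeffs (T : Finset E) (q : E) (hq : q ∈ affineSpan ℝ (T : Set E)) :
    ∃ w : E → ℝ, ∑ p ∈ T, w p = 1 ∧ ∑ p ∈ T, w p • p = q := by
  classical
  have h : (T : Set E) = Set.range (fun p : T => (p : E)) := by
    ext x; simp
  rw [h] at hq
  obtain ⟨w, hw, hq'⟩ := eq_affineCombination_of_mem_affineSpan_of_fintype hq
  rw [Finset.affineCombination_eq_linear_combination _ _ _ hw] at hq'
  refine ⟨fun p => if hp : p ∈ T then w ⟨p, hp⟩ else 0, ?_, ?_⟩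
  · rw [← Finset.sum_coe_sort, ← hw]
    simp
  · rw [← Finset.sum_coe_sort, hq']
    simp

theorem ce_dual (T : Finset E) (hT : AffineIndependent ℝ (fun p : (T : Set E) => (p : E)))
    (p : E) (hp : p ∈ T) :
    ∃ g : E →ᵃ[ℝ] ℝ, ∀ w : E → ℝ, ∑ q ∈ T, w q = 1 → g (∑ q ∈ T, w q • q) = w p := by
  classical
  obtain ⟨t, hst, hind, hsp⟩ := exists_subset_affineIndependent_affineSpan_eq_top hT
  let b : AffineBasis t ℝ E := ⟨fun p => (p : E), hind, by simpa using hsp⟩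
  refine ⟨b.coord ⟨p, hst hp⟩, fun w hw => ?_⟩
  have h1 : ∑ q ∈ T, w q • q = T.affineCombination ℝ id w := by
    rw [Finset.affineCombination_eq_linear_combination _ _ _ hw]; simp
  rw [h1, Finset.map_affineCombination _ _ _ hw,
    Finset.affineCombination_eq_linear_combination _ _ _ hw]
  have : ∀ q ∈ T, w q • ((b.coord ⟨p, hst hp⟩) ∘ id) q = if q = p then w q else 0 := by
    intro q hq
    have := b.coord_apply ⟨p, hst hp⟩ ⟨q, hst hq⟩
    have hb : b ⟨q, hst hq⟩ = q := rfl
    rw [hb] at this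
    simp only [Function.comp, id, this]
    by_cases h : p = q
    · simp [h]
    · simp [h, Ne.symm h]
  rw [Finset.sum_congr rfl this]
  simp [hp]

theorem ce_mem_intrinsic [FiniteDimensional ℝ E] (T : Finset E)
    (hT : AffineIndependent ℝ (fun p : (T : Set E) => (p : E)))
    (w : E → ℝ) (hw : ∀ p ∈ T, 0 < w p) (h1 : ∑ p ∈ T, w p = 1) :
    ∑ p ∈ T, w p • p ∈ intrinsicInterior ℝ (convexHull ℝ (T : Set E)) := by
  classical
  have hull : ∀ v : E → ℝ, (∀ p ∈ T, 0 < v p) → ∑ p ∈ T, v p = 1 →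
      ∑ p ∈ T, v p • p ∈ convexHull ℝ (T : Set E) := fun v hv hv1 =>
    (convex_convexHull ℝ _).sum_mem (fun p hp => (hv p hp).le) hv1
      (fun p hp => subset_convexHull ℝ _ hp)
  have key : ∀ p : T, ∃ g : E →ᵃ[ℝ] ℝ, ∀ w : E → ℝ, ∑ q ∈ T, w q = 1 →
      g (∑ q ∈ T, w q • q) = w p := fun p => ce_dual T hT p p.2
  choose g hg using key
  rw [mem_intrinsicInterior]
  refine ⟨⟨_, subset_affineSpan ℝ _ (hull w hw h1)⟩, ?_, rfl⟩
  rw [mem_interior]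
  refine ⟨⋂ p : T, {y | 0 < g p (y : E)}, ?_, ?_, ?_⟩
  · rintro ⟨y, hy⟩ hy'
    rw [affineSpan_convexHull] at hy
    obtain ⟨v, hv1, rfl⟩ := ce_span_coeffs T y hy
    simp only [Set.mem_iInter, Set.mem_ofPred_eq] at hy'
    refine hull v (fun p hp => ?_) hv1
    have := hy' ⟨p, hp⟩
    rwa [hg _ v hv1] at this
  · refine isOpen_iInter_of_finite fun p => ?_
    exact isOpen_lt continuous_const
      ((g p).continuous_of_finiteDimensional.comp continuous_subtype_val)
  · simp only [Set.mem_iInter, Set.mem_ofPred_eq]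
    intro p
    rw [hg _ w h1]
    exact hw p p.2

theorem ce_pos_of_mem (T : Finset E) (x : E)
    (hx : x ∈ intrinsicInterior ℝ (convexHull ℝ (T : Set E))) :
    ∃ w : E → ℝ, (∀ p ∈ T, 0 < w p) ∧ ∑ p ∈ T, w p = 1 ∧ ∑ p ∈ T, w p • p = x := by
  classical
  have hne : T.Nonempty := by
    have h := intrinsicInterior_subset hx
    exact_mod_cast convexHull_nonempty_iff.1 ⟨x, h⟩
  have hcard : (0 : ℝ) < T.card := by exact_mod_cast hne.card_pos
  rw [mem_intrinsicInterior] at hx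
  obtain ⟨⟨y, hy⟩, hyi, rfl⟩ := hx
  set u : E → ℝ := fun _ => (T.card : ℝ)⁻¹ with hu
  have hu1 : ∑ p ∈ T, u p = 1 := by
    simp [hu, hcard.ne']
  set c : E := ∑ p ∈ T, u p • p with hc
  have hcm : c ∈ affineSpan ℝ (convexHull ℝ (T : Set E)) :=
    subset_affineSpan ℝ _ ((convex_convexHull ℝ _).sum_mem (fun p hp => by positivity) hu1
      (fun p hp => subset_convexHull ℝ _ hp))
  let f : ℝ → affineSpan ℝ (convexHull ℝ (T : Set E)) :=
    fun t => ⟨AffineMap.lineMap c y (1 + t), AffineMap.lineMap_mem _ hcm hy⟩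
  have hf : Continuous f := by
    refine Continuous.subtype_mk ?_ _
    simp only [AffineMap.lineMap_apply_module]
    fun_prop
  have hf0 : f 0 = ⟨y, hy⟩ := by simp [f]
  have hnh : ∀ᶠ t in nhds (0 : ℝ), f t ∈ interior ((↑) ⁻¹' (convexHull ℝ (T : Set E)) :
      Set (affineSpan ℝ (convexHull ℝ (T : Set E)))) := by
    apply hf.continuousAt.eventually_mem
    rw [hf0]
    exact isOpen_interior.mem_nhds hyi
  obtain ⟨ε, hε, hball⟩ := Metric.eventually_nhds_iff.1 hnh
  have h2 := interior_subset (hball (y := ε / 2) (by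
    rw [Real.dist_eq, sub_zero, abs_of_pos (by positivity)]; linarith))
  set t := ε / 2 with ht
  have htpos : 0 < t := by positivity
  change AffineMap.lineMap c y (1 + t) ∈ convexHull ℝ (T : Set E) at h2
  rw [Finset.convexHull_eq] at h2
  obtain ⟨v, hv0, hv1, hv⟩ := h2
  rw [Finset.centerMass_eq_of_sum_1 _ _ hv1, AffineMap.lineMap_apply_module] at hv
  refine ⟨fun p => (1 + t)⁻¹ * (v p + t * u p), ?_, ?_, ?_⟩
  · intro p hp
    have := hv0 p hp
    have : 0 < u p := by positivity
    positivity
  · rw [← Finset.mul_sum, Finset.sum_add_distrib, ← Finset.mul_sum, hv1, hu1]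
    field_simp
  · simp only [mul_smul, add_smul, ← Finset.smul_sum, Finset.sum_add_distrib]
    simp only [id] at hv
    rw [← hc, hv]
    have : (1 + t) ≠ 0 := by positivity
    rw [inv_smul_eq_iff₀ this]
    module

/-- Signed affine dependence, positive on `A`, negative on `B`. -/
def CESigned (A B : Finset E) : Prop :=
  ∃ a b : E → ℝ, (∀ p ∈ A, 0 < a p) ∧ (∀ p ∈ B, 0 < b p) ∧
    ∑ p ∈ A, a p = ∑ p ∈ B, b p ∧ ∑ p ∈ A, a p • p = ∑ p ∈ B, b p • p

theorem CESigned.symm {A B : Finset E} (h : CESigned A B) : CESigned B A := by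
  obtain ⟨a, b, ha, hb, h1, h2⟩ := h
  exact ⟨b, a, hb, ha, h1.symm, h2.symm⟩

theorem ce_small (T : Finset E) (a c : E → ℝ) (ha : ∀ p ∈ T, 0 < a p) :
    ∀ᶠ t in nhdsWithin (0 : ℝ) (Set.Ioi 0), ∀ p ∈ T, 0 < a p + t * c p := by
  rw [Filter.eventually_all_finset]
  intro p hp
  apply Filter.Eventually.filter_mono nhdsWithin_le_nhds
  have : Continuous fun t : ℝ => a p + t * c p := by fun_prop
  exact this.continuousAt.eventually_mem ((isOpen_Ioi (a := (0 : ℝ))).mem_nhds (by simpa using ha p hp))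

open Classical in
theorem CESigned.insert {A B : Finset E} (h : CESigned A B) (hd : Disjoint A B)
    (hs : affineSpan ℝ ((A ∪ B : Finset E) : Set E) = ⊤) (q : E) (hq : q ∉ A) :
    CESigned (insert q A) B := by
  obtain ⟨a, b, ha, hb, h1, h2⟩ := h
  obtain ⟨c, hc1, hc2⟩ := ce_span_coeffs (A ∪ B) q (by rw [hs]; trivial)
  rw [Finset.sum_union hd] at hc1 hc2
  obtain ⟨t, ⟨hta, htb⟩, ht⟩ := (((ce_small A a (fun p => - c p) ha).and
    (ce_small B b c hb)).and self_mem_nhdsWithin).exists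
  have ht : 0 < t := ht
  refine ⟨fun p => if p = q then t else a p + t * (- c p), fun p => b p + t * c p, ?_, htb, ?_, ?_⟩
  · intro p hp
    by_cases hpq : p = q
    · simpa [hpq] using ht
    · simpa [hpq] using hta p (Finset.mem_of_mem_insert_of_ne hp hpq)
  · rw [Finset.sum_insert hq, Finset.sum_congr rfl (g := fun p => a p + t * (- c p))]
    · simp only [if_true, Finset.sum_add_distrib, ← Finset.mul_sum, Finset.sum_neg_distrib]
      linear_combination h1 - t * hc1
    · intro p hp
      have hne : p ≠ q := fun h => hq (h ▸ hp)
      simp [hne]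
  · rw [Finset.sum_insert hq, Finset.sum_congr rfl (g := fun p => (a p + t * (- c p)) • p)]
    · simp only [if_true, add_smul, mul_smul, neg_smul, smul_neg, Finset.sum_add_distrib,
        ← Finset.smul_sum, Finset.sum_neg_distrib]
      rw [h2, ← hc2]
      module
    · intro p hp
      have hne : p ≠ q := fun h => hq (h ▸ hp)
      simp [hne]

open Classical in
theorem CESigned.extend {A B : Finset E} (h : CESigned A B)
    (hs : affineSpan ℝ ((A ∪ B : Finset E) : Set E) = ⊤) (D : Finset E)
    (hDB : Disjoint (A ∪ D) B) : CESigned (A ∪ D) B := by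
  induction D using Finset.induction_on with
  | empty => simpa using h
  | insert q D hq ih =>
    rw [Finset.union_insert] at hDB ⊢
    rw [Finset.disjoint_insert_left] at hDB
    have ih := ih hDB.2
    by_cases hqA : q ∈ A ∪ D
    · rwa [Finset.insert_eq_of_mem hqA]
    · refine ih.insert hDB.2 ?_ q hqA
      rw [eq_top_iff, ← hs]
      apply affineSpan_mono
      intro x
      simp
      tauto

open Classical in
theorem CESigned.extend_both {A B A' B' : Finset E} (h : CESigned A B)
    (hs : affineSpan ℝ ((A : Set E) ∪ (B : Set E)) = ⊤) (hA : A ⊆ A') (hB : B ⊆ B')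
    (hd : Disjoint A' B') : CESigned A' B' := by
  have h1 : CESigned A' B := by
    have := h.extend (by rw [Finset.coe_union]; exact hs) A' (by
      rw [Finset.union_eq_right.2 hA]; exact hd.mono_right hB)
    rwa [Finset.union_eq_right.2 hA] at this
  have h2 := h1.symm.extend (by
    rw [eq_top_iff, ← hs]
    apply affineSpan_mono
    intro x
    have := @hA x
    simp
    tauto) B' (by rw [Finset.union_eq_right.2 hB]; exact hd.symm)
  rw [Finset.union_eq_right.2 hB] at h2
  exact h2.symm

end helpers


theorem crossing_extension (d : ℕ) (S : Finset (EuclideanSpace ℝ (Fin d)))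
    (hGP : GenPos d S) (A B : Finset (EuclideanSpace ℝ (Fin d)))
    (hA : A ⊆ S) (hB : B ⊆ S) (hAB : Disjoint A B)
    (hcross : (intrinsicInterior ℝ (convexHull ℝ (A : Set (EuclideanSpace ℝ (Fin d)))) ∩
      intrinsicInterior ℝ (convexHull ℝ (B : Set (EuclideanSpace ℝ (Fin d))))).Nonempty) :
    ∀ A' B' : Finset (EuclideanSpace ℝ (Fin d)), A' ⊆ S → B' ⊆ S → A ⊆ A' → B ⊆ B' →
      Disjoint A' B' → A'.card ≤ d → B'.card ≤ d →
      (intrinsicInterior ℝ (convexHull ℝ (A' : Set (EuclideanSpace ℝ (Fin d)))) ∩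
        intrinsicInterior ℝ (convexHull ℝ (B' : Set (EuclideanSpace ℝ (Fin d))))).Nonempty := by
  classical
  intro A' B' hA' hB' hAA hBB hd hcA hcB
  obtain ⟨x, hxA, hxB⟩ := hcross
  obtain ⟨a, ha, ha1, hax⟩ := ce_pos_of_mem A x hxA
  obtain ⟨b, hb, hb1, hbx⟩ := ce_pos_of_mem B x hxB
  have hAne : A.Nonempty := by
    rw [Finset.nonempty_iff_ne_empty]; rintro rfl; simp at ha1
  have hsub : A ∪ B ⊆ S := Finset.union_subset hA hB
  have hcard : d + 1 ≤ (A ∪ B).card := by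
    by_contra hlt
    have hind := hGP (A ∪ B) hsub (by omega)
    obtain ⟨p, hp⟩ := hAne
    obtain ⟨g, hg⟩ := ce_dual (A ∪ B) hind p (Finset.mem_union_left _ hp)
    have e1 := hg (fun q => if q ∈ A then a q else 0) (by
      rw [Finset.sum_ite_mem, Finset.union_inter_cancel_left, ha1])
    have e2 := hg (fun q => if q ∈ B then b q else 0) (by
      rw [Finset.sum_ite_mem, Finset.union_inter_cancel_right, hb1])
    simp only [ite_smul, zero_smul] at e1 e2
    rw [Finset.sum_ite_mem, Finset.union_inter_cancel_left, hax, if_pos hp] at e1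
    rw [Finset.sum_ite_mem, Finset.union_inter_cancel_right, hbx,
      if_neg (Finset.disjoint_left.1 hAB hp)] at e2
    have := ha p hp
    linarith
  have hs : affineSpan ℝ ((A ∪ B : Finset (EuclideanSpace ℝ (Fin d))) :
      Set (EuclideanSpace ℝ (Fin d))) = ⊤ := by
    obtain ⟨T, hT, hTc⟩ := Finset.exists_subset_card_eq hcard
    have hind := hGP T (hT.trans hsub) hTc.le
    have := hind.affineSpan_eq_top_iff_card_eq_finrank_add_one.2 (by simp [hTc])
    rw [Subtype.range_coe] at this
    rw [eq_top_iff, ← this]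
    exact affineSpan_mono _ (by exact_mod_cast hT)
  have h0 : CESigned A B := ⟨a, b, ha, hb, by rw [ha1, hb1], by rw [hax, hbx]⟩
  obtain ⟨a', b', ha', hb', e1, e2⟩ := h0.extend_both (by rw [Finset.coe_union] at hs; exact hs) hAA hBB hd
  have hpos : 0 < ∑ p ∈ A', a' p := Finset.sum_pos ha' (hAne.mono hAA)
  set s := ∑ p ∈ A', a' p with hsdef
  have hiA := ce_mem_intrinsic A' (hGP A' hA' (by omega)) (fun p => s⁻¹ * a' p)
    (fun p hp => mul_pos (inv_pos.2 hpos) (ha' p hp))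
    (by rw [← Finset.mul_sum, ← hsdef]; exact inv_mul_cancel₀ hpos.ne')
  have hiB := ce_mem_intrinsic B' (hGP B' hB' (by omega)) (fun p => s⁻¹ * b' p)
    (fun p hp => mul_pos (inv_pos.2 hpos) (hb' p hp))
    (by rw [← Finset.mul_sum, ← e1]; exact inv_mul_cancel₀ hpos.ne')
  simp only [mul_smul, ← Finset.smul_sum] at hiA hiB
  rw [← e2] at hiB
  exact ⟨_, hiA, hiB⟩
end

section
/- For every set of 6 points in general position in ℝ^3, there exist two disjoint 3-element subsets A and B of the point set such that the intrinsic (relative) interiors of the convex hulls of A and of B (i.e., the open triangles spanned by A and by B) have a common point. -/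
/-- A finite set of points in `ℝ^3` is in general position if every subset of at most
`4` of the points is affinely independent. -/
def GenPos3 (S : Finset (EuclideanSpace ℝ (Fin 3))) : Prop :=
  ∀ T ⊆ S, T.card ≤ 4 →
    AffineIndependent ℝ (fun p : (T : Set (EuclideanSpace ℝ (Fin 3))) =>
      (p : EuclideanSpace ℝ (Fin 3)))

open Finset in
lemma csp_interior {ι E : Type*} [Fintype ι] [DecidableEq ι] [NormedAddCommGroup E]
    [NormedSpace ℝ E] [FiniteDimensional ℝ E] (b : AffineBasis ι ℝ E) (J : Finset ι)
    (w : ι → ℝ) (hw : ∀ i ∈ J, 0 < w i) (hw0 : ∀ i, i ∉ J → w i = 0) (hs : ∑ i, w i = 1) :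
    (∑ i, w i • b i) ∈ intrinsicInterior ℝ (convexHull ℝ (b '' (J : Set ι))) := by
  have hx : (∑ i, w i • b i) ∈ convexHull ℝ (b '' (J : Set ι)) := by
    have : ∑ i, w i • b i = ∑ i ∈ J, w i • b i :=
      (sum_subset (subset_univ J) (fun i _ hi => by simp [hw0 i hi])).symm
    rw [this]
    refine (convex_convexHull ℝ _).sum_mem (fun i hi => (hw i hi).le) ?_ ?_
    · rw [← hs]; exact sum_subset (subset_univ J) (fun i _ hi => hw0 i hi)
    · intro i hi; exact subset_convexHull ℝ _ ⟨i, hi, rfl⟩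
  have hcoord : ∀ i, b.coord i (∑ i, w i • b i) = w i := by
    intro i
    have h := b.coord_apply_combination_of_mem (s := univ) (mem_univ i) hs
    rwa [Finset.affineCombination_eq_linear_combination _ _ _ hs] at h
  rw [mem_intrinsicInterior]
  refine ⟨⟨_, subset_affineSpan ℝ _ hx⟩, ?_, rfl⟩
  rw [mem_interior]
  refine ⟨(↑) ⁻¹' {y : E | ∀ i ∈ J, 0 < b.coord i y}, ?_, ?_, ?_⟩
  · rintro ⟨y, hy⟩ hyU
    have hyU' : ∀ i ∈ J, 0 < b.coord i y := hyU
    show y ∈ convexHull ℝ (b '' (J : Set ι))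
    rw [affineSpan_convexHull] at hy
    have h0 : ∀ i, i ∉ J → b.coord i y = 0 := by
      intro i hi
      have hle : affineSpan ℝ (b '' (J : Set ι)) ≤
          (affineSpan ℝ ({0} : Set ℝ)).comap (b.coord i) := by
        rw [affineSpan_le]
        rintro _ ⟨j, hj, rfl⟩
        have : i ≠ j := fun h => hi (h ▸ hj)
        simp [b.coord_apply_ne this]
      simpa using hle hy
    have h1 : ∑ i, b.coord i y = 1 := b.sum_coord_apply_eq_one y
    rw [← b.linear_combination_coord_eq_self y]
    have : ∑ i, b.coord i y • b i = ∑ i ∈ J, b.coord i y • b i :=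
      (sum_subset (subset_univ J) (fun i _ hi => by simp [h0 i hi])).symm
    rw [this]
    refine (convex_convexHull ℝ _).sum_mem (fun i hi => (hyU' i hi).le) ?_ ?_
    · rw [← h1]; exact sum_subset (subset_univ J) (fun i _ hi => h0 i hi)
    · intro i hi; exact subset_convexHull ℝ _ ⟨i, hi, rfl⟩
  · refine IsOpen.preimage continuous_subtype_val ?_
    have : {y : E | ∀ i ∈ J, 0 < b.coord i y} = ⋂ i ∈ J, {y | 0 < b.coord i y} := by
      ext; simp
    rw [this]
    refine isOpen_biInter_finset fun i _ => ?_
    exact isOpen_lt continuous_const (AffineMap.continuous_of_finiteDimensional _)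
  · intro i hi
    show 0 < b.coord i (∑ i, w i • b i)
    rw [hcoord]; exact hw i hi

/-- Combinatorial core: rotating the sign vector one coordinate at a time hits a balanced split. -/
lemma csp_comb : ∀ e : Fin 6 → Bool, ∃ k : Fin 6,
    (Finset.univ.filter (fun i => xor (decide (i < k)) (e i) = true)).card = 3 := by
  decide

/-- Sorted real version. -/
lemma csp_balance (u v : Fin 6 → ℝ) (hu : ∀ i, u i ≠ 0)
    (hd : ∀ i j, i ≠ j → u i * v j - u j * v i ≠ 0) :
    ∃ t : ℝ, (∀ i, v i - t * u i ≠ 0) ∧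
      (Finset.univ.filter (fun i => 0 < v i - t * u i)).card = 3 := by
  set r : Fin 6 → ℝ := fun i => v i / u i with hr
  have hinj : Function.Injective r := by
    intro i j hij
    by_contra hne
    apply hd i j hne
    simp only [hr] at hij
    rw [div_eq_div_iff (hu i) (hu j)] at hij
    linarith
  set σ := Tuple.sort r
  have hmono : StrictMono (r ∘ σ) :=
    (Tuple.monotone_sort r).strictMono_of_injective (hinj.comp σ.injective)
  obtain ⟨k, hk⟩ := csp_comb (fun i => decide (0 < u (σ i)))
  obtain ⟨t, ht1, ht2⟩ : ∃ t : ℝ, (∀ i, i < k → r (σ i) < t) ∧ (∀ i, k ≤ i → t < r (σ i)) := by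
    by_cases h0 : k = 0
    · subst h0
      refine ⟨r (σ 0) - 1, fun i hi => absurd hi (by simp), fun i hi => ?_⟩
      have := hmono.monotone hi
      simp only [Function.comp] at this
      linarith
    · obtain ⟨m, rfl⟩ := Fin.exists_succ_eq.mpr h0
      have hlt : r (σ m.castSucc) < r (σ m.succ) := hmono (Fin.castSucc_lt_succ)
      refine ⟨(r (σ m.castSucc) + r (σ m.succ)) / 2, fun i hi => ?_, fun i hi => ?_⟩
      · have := hmono.monotone (Fin.le_castSucc_iff.mpr hi)
        simp only [Function.comp] at this
        linarith
      · have := hmono.monotone hi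
        simp only [Function.comp] at this
        linarith
  have hfac : ∀ i, v i - t * u i = (r i - t) * u i := by
    intro i
    simp only [hr]
    field_simp [hu i]
  have hne : ∀ i, r i - t ≠ 0 := by
    intro i
    obtain ⟨j, rfl⟩ := σ.surjective i
    rcases lt_or_ge j k with h | h
    · have := ht1 j h; intro h'; linarith
    · have := ht2 j h; intro h'; linarith
  have hpos : ∀ i, (0 < v (σ i) - t * u (σ i)) ↔
      xor (decide (i < k)) (decide (0 < u (σ i))) = true := by
    intro i
    rw [hfac]
    rcases lt_or_ge i k with h | h
    · have h1 := ht1 i h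
      have h2 : r (σ i) - t < 0 := by linarith
      rcases lt_or_gt_of_ne (hu (σ i)) with h3 | h3
      · simp [h, h3.le, mul_pos_of_neg_of_neg h2 h3]
      · simp [h, h3, h1.le]
    · have h1 := ht2 i h
      have h2 : 0 < r (σ i) - t := by linarith
      simp [not_lt.mpr h, h2]
  refine ⟨t, fun i => by rw [hfac]; exact mul_ne_zero (hne i) (hu i), ?_⟩
  rw [← hk]
  symm
  refine Finset.card_bij (fun i _ => σ i) ?_ ?_ ?_
  · intro i hi
    rw [Finset.mem_filter] at hi ⊢
    exact ⟨Finset.mem_univ _, (hpos i).mpr hi.2⟩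
  · intro a _ b _ h; exact σ.injective h
  · intro j hj
    obtain ⟨i, rfl⟩ := σ.surjective j
    rw [Finset.mem_filter] at hj
    exact ⟨i, by rw [Finset.mem_filter]; exact ⟨Finset.mem_univ _, (hpos i).mp hj.2⟩, rfl⟩

/-- A two-dimensional family of vectors, no nonzero one having two zero coordinates, contains a
balanced vector. -/
lemma csp_space (D : Submodule ℝ (Fin 6 → ℝ)) (hD : 1 < Module.finrank ℝ D)
    (hz : ∀ w ∈ D, ∀ i j, i ≠ j → w i = 0 → w j = 0 → w = 0) :
    ∃ w ∈ D, (∀ i, w i ≠ 0) ∧ (Finset.univ.filter (fun i => 0 < w i)).card = 3 := by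
  have : Nontrivial D := Module.nontrivial_of_finrank_pos (R := ℝ) (by omega)
  obtain ⟨x, hx⟩ := exists_ne (0 : D)
  obtain ⟨y, hy⟩ := exists_linearIndependent_pair_of_one_lt_finrank hD hx
  rw [LinearIndependent.pair_iff] at hy
  have hli : ∀ a b : ℝ, (∀ i, a * x.1 i + b * y.1 i = 0) → a = 0 ∧ b = 0 := by
    intro a b h
    apply hy
    ext i
    simpa using h i
  have hz2 : ∀ i j, i ≠ j → ∀ a b : ℝ, a * x.1 i + b * y.1 i = 0 → a * x.1 j + b * y.1 j = 0 →
      a = 0 ∧ b = 0 := by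
    intro i j hij a b h1 h2
    apply hli
    have := hz (a • x.1 + b • y.1) (D.add_mem (D.smul_mem _ x.2) (D.smul_mem _ y.2)) i j hij
      (by simpa using h1) (by simpa using h2)
    intro i
    simpa using congrFun this i
  have hd : ∀ i j, i ≠ j → x.1 i * y.1 j - x.1 j * y.1 i ≠ 0 := by
    intro i j hij h
    have h1 := hz2 i j hij (y.1 i) (-x.1 i) (by ring) (by linarith)
    have h2 := hz2 i j hij (y.1 j) (-x.1 j) (by linarith) (by ring)
    have h3 := hz2 i j hij 1 0 (by linarith [h1.2]) (by linarith [h2.2])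
    exact one_ne_zero h3.1
  obtain ⟨s, hs⟩ := Infinite.exists_notMem_finset (Finset.univ.image fun i => - x.1 i / y.1 i)
  have hu : ∀ i, x.1 i + s * y.1 i ≠ 0 := by
    intro i h
    by_cases hyi : y.1 i = 0
    · have hxi : x.1 i = 0 := by simpa [hyi] using h
      obtain ⟨j, hj⟩ := exists_ne i
      apply hd i j hj.symm
      simp [hyi, hxi]
    · apply hs
      rw [Finset.mem_image]
      refine ⟨i, Finset.mem_univ _, ?_⟩
      rw [div_eq_iff hyi]; linarith
  obtain ⟨t, ht1, ht2⟩ := csp_balance (fun i => x.1 i + s * y.1 i) y.1 hu (by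
    intro i j hij h
    apply hd i j hij
    linarith)
  refine ⟨y.1 - t • (x.1 + s • y.1), ?_, ?_, ?_⟩
  · exact D.sub_mem y.2 (D.smul_mem _ (D.add_mem x.2 (D.smul_mem _ y.2)))
  · intro i; exact ht1 i
  · exact ht2

lemma csp_triangle (p : Fin 6 → EuclideanSpace ℝ (Fin 3))
    (hp : ∀ T : Finset (Fin 6), T.card = 4 → AffineIndependent ℝ (fun k : T => p k))
    (J : Finset (Fin 6)) (hJ : J.card = 3) (w : Fin 6 → ℝ) (hw : ∀ i ∈ J, 0 < w i)
    (hs : ∑ i ∈ J, w i = 1) :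
    ∑ i ∈ J, w i • p i ∈ intrinsicInterior ℝ (convexHull ℝ (p '' (J : Set (Fin 6)))) := by
  obtain ⟨T, hJT, hT⟩ := Finset.exists_superset_card_eq (s := J) (n := 4) (by omega) (by simp)
  have hai := hp T hT
  let b : AffineBasis T ℝ (EuclideanSpace ℝ (Fin 3)) :=
    ⟨fun k : T => p k, hai, by
      rw [hai.affineSpan_eq_top_iff_card_eq_finrank_add_one]
      simp [hT]⟩
  have key : ∀ {M : Type} [AddCommMonoid M] (f : Fin 6 → M),
      ∑ i ∈ J, f i = ∑ i : T, if i.1 ∈ J then f i.1 else 0 := by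
    intro M _ f
    rw [Finset.sum_coe_sort T (fun i => if i ∈ J then f i else 0), ← Finset.sum_filter,
      Finset.filter_mem_eq_inter, Finset.inter_eq_right.mpr hJT]
  have h := csp_interior b (Finset.univ.filter (fun i : T => i.1 ∈ J))
    (fun i => if i.1 ∈ J then w i else 0)
    (by intro i hi; have := (Finset.mem_filter.mp hi).2; simpa [this] using hw _ this)
    (by intro i hi; simpa using fun h => absurd h (by simpa using hi))
    (by rw [← hs, key])
  have e1 : ∑ i ∈ J, w i • p i = ∑ i : T, (if i.1 ∈ J then w i else 0) • b i := by
    rw [key]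
    refine Finset.sum_congr rfl fun i _ => ?_
    split_ifs
    · rfl
    · simp
  have e2 : p '' (J : Set (Fin 6)) =
      b '' ((Finset.univ.filter (fun i : T => i.1 ∈ J) : Finset T) : Set T) := by
    ext z
    constructor
    · rintro ⟨i, hi, rfl⟩
      exact ⟨⟨i, hJT hi⟩, by simpa using hi, rfl⟩
    · rintro ⟨i, hi, rfl⟩
      exact ⟨i.1, by simpa using hi, rfl⟩
  rw [e1, e2]
  exact h

theorem crossing_of_six_points (S : Finset (EuclideanSpace ℝ (Fin 3)))
    (hS : S.card = 6) (hGP : GenPos3 S) :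
    ∃ A B : Finset (EuclideanSpace ℝ (Fin 3)), A ⊆ S ∧ B ⊆ S ∧ Disjoint A B ∧
      A.card = 3 ∧ B.card = 3 ∧
      (intrinsicInterior ℝ (convexHull ℝ (A : Set (EuclideanSpace ℝ (Fin 3)))) ∩
        intrinsicInterior ℝ (convexHull ℝ (B : Set (EuclideanSpace ℝ (Fin 3))))).Nonempty := by
  classical
  let e := S.equivFinOfCardEq hS
  let p : Fin 6 → EuclideanSpace ℝ (Fin 3) := fun i => (e.symm i).1
  have pinj : Function.Injective p := Subtype.val_injective.comp e.symm.injective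
  have pS : ∀ i, p i ∈ S := fun i => (e.symm i).2
  have hp : ∀ T : Finset (Fin 6), T.card = 4 → AffineIndependent ℝ (fun k : T => p k) := by
    intro T hT
    have h := hGP (T.image p) (by intro z hz; obtain ⟨i, _, rfl⟩ := Finset.mem_image.mp hz; exact pS i)
      (by rw [Finset.card_image_of_injective _ pinj, hT])
    let f : T ↪ ((T.image p : Finset _) : Set (EuclideanSpace ℝ (Fin 3))) :=
      ⟨fun k => ⟨p k, by simpa using ⟨k.1, k.2, rfl⟩⟩, fun a b hab => by
        apply Subtype.ext; apply pinj; exact Subtype.mk.inj hab⟩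
    exact h.comp_embedding f
  let L : (Fin 6 → ℝ) →ₗ[ℝ] EuclideanSpace ℝ (Fin 3) × ℝ :=
    (Fintype.linearCombination ℝ p).prod (Fintype.linearCombination ℝ (fun _ => (1 : ℝ)))
  have hL : ∀ w ∈ LinearMap.ker L, ∑ i, w i • p i = 0 ∧ ∑ i, w i = 0 := by
    intro w hw
    rw [LinearMap.mem_ker] at hw
    have h1 := congrArg Prod.fst hw
    have h2 := congrArg Prod.snd hw
    simp [L, Fintype.linearCombination_apply] at h1 h2
    exact ⟨h1, h2⟩
  have hrank : 1 < Module.finrank ℝ (LinearMap.ker L) := by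
    have h1 := LinearMap.finrank_range_add_finrank_ker L
    have h2 := Submodule.finrank_le (LinearMap.range L)
    simp at h1 h2
    omega
  obtain ⟨w, hwD, hw0, hw3⟩ := csp_space (LinearMap.ker L) hrank (by
    intro w hw i j hij hi hj
    obtain ⟨h1, h2⟩ := hL w hw
    have hai := hp (Finset.univ \ {i, j}) (by
      rw [Finset.card_sdiff_of_subset (Finset.subset_univ _), Finset.card_pair hij]; simp)
    rw [affineIndependent_iff] at hai
    have key : ∀ {M : Type} [AddCommMonoid M] (f : Fin 6 → M), f i = 0 → f j = 0 →
        ∑ k : (Finset.univ \ {i, j} : Finset (Fin 6)), f k = ∑ k, f k := by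
      intro M _ f hfi hfj
      rw [Finset.sum_coe_sort (Finset.univ \ {i, j}) f]
      refine Finset.sum_subset (Finset.subset_univ _) ?_
      intro k _ hk
      simp at hk
      by_cases h : k = i
      · rw [h, hfi]
      · rw [hk h, hfj]
    have := hai Finset.univ (fun k => w k) (by rw [key w hi hj, h2])
      (by rw [key (fun k => w k • p k) (by simp [hi]) (by simp [hj]), h1])
    funext k
    by_cases h : k = i
    · rw [h, hi]; rfl
    by_cases h' : k = j
    · rw [h', hj]; rfl
    exact this ⟨k, by simp [h, h']⟩ (Finset.mem_univ _))
  obtain ⟨h1, h2⟩ := hL w hwD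
  set J := Finset.univ.filter (fun i => 0 < w i) with hJ
  have hJc : Jᶜ.card = 3 := by rw [Finset.card_compl, hw3]; simp
  have hJpos : ∀ i ∈ J, 0 < w i := fun i hi => (Finset.mem_filter.mp hi).2
  have hJneg : ∀ i ∈ Jᶜ, 0 < - w i := by
    intro i hi
    have : ¬ 0 < w i := by simpa [hJ] using hi
    have := lt_of_le_of_ne (not_lt.mp this) (hw0 i)
    linarith
  set c := ∑ i ∈ J, w i with hc
  have hcpos : 0 < c := Finset.sum_pos hJpos (Finset.card_pos.mp (by omega))
  have hcs : c + ∑ i ∈ Jᶜ, w i = 0 := by rw [hc, Finset.sum_add_sum_compl, h2]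
  have hps : ∑ i ∈ J, w i • p i + ∑ i ∈ Jᶜ, w i • p i = 0 := by
    rw [Finset.sum_add_sum_compl, h1]
  have hA := csp_triangle p hp J hw3 (fun i => c⁻¹ * w i)
    (fun i hi => mul_pos (inv_pos.mpr hcpos) (hJpos i hi))
    (by rw [← Finset.mul_sum, ← hc, inv_mul_cancel₀ hcpos.ne'])
  have hB := csp_triangle p hp Jᶜ hJc (fun i => c⁻¹ * - w i)
    (fun i hi => mul_pos (inv_pos.mpr hcpos) (hJneg i hi))
    (by
      rw [← Finset.mul_sum, Finset.sum_neg_distrib, ← eq_neg_of_add_eq_zero_left hcs,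
        inv_mul_cancel₀ hcpos.ne'])
  have heq : ∑ i ∈ J, (c⁻¹ * w i) • p i = ∑ i ∈ Jᶜ, (c⁻¹ * - w i) • p i := by
    simp only [mul_smul, neg_smul, ← Finset.smul_sum, Finset.sum_neg_distrib]
    rw [eq_neg_of_add_eq_zero_left hps]
  refine ⟨J.image p, Jᶜ.image p, ?_, ?_, ?_, ?_, ?_, ?_⟩
  · intro z hz; obtain ⟨i, _, rfl⟩ := Finset.mem_image.mp hz; exact pS i
  · intro z hz; obtain ⟨i, _, rfl⟩ := Finset.mem_image.mp hz; exact pS i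
  · rw [Finset.disjoint_image pinj]; exact disjoint_compl_right
  · rw [Finset.card_image_of_injective _ pinj, hw3]
  · rw [Finset.card_image_of_injective _ pinj, hJc]
  · rw [Finset.coe_image, Finset.coe_image]
    exact ⟨_, hA, heq ▸ hB⟩
end
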